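/- Let f : X → Y be a σ-perfect map between finite-dimensional metrizable spaces and let p ≥ 1 be an integer. Then the space C*(X, ℝ^p) of all bounded continuous maps from X into ℝ^p, endowed with the source limitation topology, contains a dense G_δ-subset ℋ consisting of f-regularly branched maps, i.e. maps g such that dim B_n(f×g) ≤ n·(dim f + dim Y) − (n−1)·(p + dim Y) for every n ≥ 1. -/

import Mathlib

open Set Topology Metric BoundedContinuousFunction

noncomputable section

/-- Covering dimension at most `n` (for a natural number `n`): every finite open cover
has an open refinement covering the space such that every point belongs to at most
`n + 1` members of the refinement. -/
def CovDimLENat (X : Type*) [TopologicalSpace X] (n : ℕ) : Prop :=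
  ∀ 𝒰 : Set (Set X), 𝒰.Finite → (∀ U ∈ 𝒰, IsOpen U) → ⋃₀ 𝒰 = Set.univ →
    ∃ 𝒱 : Set (Set X), (∀ V ∈ 𝒱, IsOpen V) ∧ ⋃₀ 𝒱 = Set.univ ∧
      (∀ V ∈ 𝒱, ∃ U ∈ 𝒰, V ⊆ U) ∧
      ∀ x : X, {V ∈ 𝒱 | x ∈ V}.Finite ∧ {V ∈ 𝒱 | x ∈ V}.ncard ≤ n + 1

/-- Covering dimension at most `n` for an integer `n`; negative bounds mean the space
is empty (`dim ∅ = -1`). -/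
def CovDimLE (X : Type*) [TopologicalSpace X] (n : ℤ) : Prop :=
  IsEmpty X ∨ ∃ k : ℕ, (k : ℤ) ≤ n ∧ CovDimLENat X k

/-- A space is finite-dimensional if its covering dimension is at most `n` for some `n`. -/
def FiniteDimSpace (X : Type*) [TopologicalSpace X] : Prop :=
  ∃ n : ℕ, CovDimLENat X n

/-- A perfect map: continuous, closed, with compact fibers. -/
def IsPerfectMap {X Y : Type*} [TopologicalSpace X] [TopologicalSpace Y] (f : X → Y) : Prop :=
  Continuous f ∧ IsClosedMap f ∧ ∀ y : Y, IsCompact (f ⁻¹' {y})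

/-- A σ-perfect map: `X` is a countable union of closed sets `A i` whose images are
closed and on which `f` restricts to a perfect map onto its image. -/
def IsSigmaPerfectMap {X Y : Type*} [TopologicalSpace X] [TopologicalSpace Y] (f : X → Y) :
    Prop :=
  Continuous f ∧ ∃ A : ℕ → Set X, (⋃ i, A i) = Set.univ ∧
    ∀ i, IsClosed (A i) ∧ IsClosed (f '' A i) ∧
      IsPerfectMap (Set.MapsTo.restrict f (A i) (f '' A i) (Set.mapsTo_image f (A i)))

/-- `dim f ≤ k`: every fiber of `f` has covering dimension at most `k`. -/
def DimMapLE {X Y : Type*} [TopologicalSpace X] [TopologicalSpace Y] (f : X → Y) (k : ℤ) :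
    Prop :=
  ∀ y : Y, CovDimLE (f ⁻¹' {y}) k

/-- `B_n(h)`: the set of points of the codomain having at least `n` preimages. -/
def BranchSet {X Z : Type*} (h : X → Z) (n : ℕ) : Set Z :=
  {z | ∃ S : Finset X, n ≤ S.card ∧ ∀ x ∈ S, h x = z}

/-- The source limitation topology on the space of bounded continuous maps. -/
def sourceLimitation (X E : Type*) [TopologicalSpace X] [PseudoMetricSpace E] :
    TopologicalSpace (X →ᵇ E) where
  IsOpen U := ∀ g ∈ U, ∃ α : X → ℝ, Continuous α ∧ (∀ x, 0 < α x) ∧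
    ∀ h : X →ᵇ E, (∀ x, dist (h x) (g x) ≤ α x) → h ∈ U
  isOpen_univ := fun g _ =>
    ⟨fun _ => 1, continuous_const, fun _ => one_pos, fun _ _ => trivial⟩
  isOpen_inter := by
    rintro U V hU hV g ⟨hgU, hgV⟩
    obtain ⟨α, hαc, hαp, hα⟩ := hU g hgU
    obtain ⟨β, hβc, hβp, hβ⟩ := hV g hgV
    exact ⟨fun x => min (α x) (β x), hαc.min hβc, fun x => lt_min (hαp x) (hβp x),
      fun h hh => ⟨hα h fun x => (hh x).trans (min_le_left _ _),
        hβ h fun x => (hh x).trans (min_le_right _ _)⟩⟩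
  isOpen_sUnion := by
    rintro S hS g ⟨U, hU, hgU⟩
    obtain ⟨α, hc, hp, h⟩ := hS U hU g hgU
    exact ⟨α, hc, hp, fun h' hh' => ⟨U, hU, h h' hh'⟩⟩

/-- A C-space. -/
def IsCSpace (Y : Type*) [TopologicalSpace Y] : Prop :=
  ∀ 𝒰 : ℕ → Set (Set Y), (∀ n, (∀ U ∈ 𝒰 n, IsOpen U) ∧ ⋃₀ 𝒰 n = Set.univ) →
    ∃ 𝒱 : ℕ → Set (Set Y),
      (∀ n, (∀ V ∈ 𝒱 n, IsOpen V) ∧ (∀ V ∈ 𝒱 n, ∃ U ∈ 𝒰 n, V ⊆ U) ∧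
        (𝒱 n).Pairwise (Disjoint · ·)) ∧
      ⋃₀ (⋃ n, 𝒱 n) = Set.univ

/-- `F` is a `Z_m`-set in `M`: `F` is closed and the maps from the `m`-cube avoiding `F`
are dense in `C(𝕀^m, M)` (uniform convergence topology). -/
def IsZmSet (m : ℕ) {M : Type*} [TopologicalSpace M] (F : Set M) : Prop :=
  IsClosed F ∧ Dense {u : C((Fin m → unitInterval), M) | ∀ z, u z ∉ F}

/-- `F` is a `Z`-set in `M` if it is a `Z_m`-set for all `m`. -/
def IsZSet {M : Type*} [TopologicalSpace M] (F : Set M) : Prop :=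
  ∀ m : ℕ, IsZmSet m F

end

/-- Large inductive dimension zero (or empty). -/
def IndZero (Z : Type*) [TopologicalSpace Z] : Prop :=
  ∀ A B : Set Z, IsClosed A → IsClosed B → Disjoint A B → ∃ P, IsClopen P ∧ A ⊆ P ∧ Disjoint P B

/-- The set `Z` is zero-dimensional relative to the ambient space. -/
def PZero.{uz} {Y : Type uz} [TopologicalSpace Y] (Z : Set Y) : Prop :=
  ∀ (ι : Type uz) (U : ι → Set Y), (∀ i, IsOpen (U i)) → Z ⊆ ⋃ i, U i →
    ∃ V : ι → Set Y, (∀ i, IsOpen (V i)) ∧ (∀ i j, i ≠ j → Disjoint (V i) (V j)) ∧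
      (∀ i, V i ⊆ U i) ∧ Z ⊆ ⋃ i, V i

/-- A base structure on a space. -/
structure LStruct (T : Type*) [TopologicalSpace T] (Λ ι J : Type*) where
  L : Λ → Set T
  closedL : ∀ l, IsClosed (L l)
  N : ι → J → Set T
  openN : ∀ s j, IsOpen (N s j)
  disj : ∀ s i j, i ≠ j → Disjoint (N s i) (N s j)
  FL : ι → Set Λ
  clos : ∀ s, closure (⋃ j, N s j) ⊆ (⋃ j, N s j) ∪ ⋃ l ∈ FL s, L l
  base : ∀ x, ∀ U ∈ 𝓝 x, ∃ s j, x ∈ N s j ∧ N s j ⊆ U ∧ ∀ l ∈ FL s, x ∉ L l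

/-- Pull back of a structure. -/
def LStruct.comap {T Z Λ ι J : Type*} [TopologicalSpace T] [TopologicalSpace Z]
    (S : LStruct T Λ ι J) (e : Z → T) (he : IsInducing e) : LStruct Z Λ ι J where
  L l := e ⁻¹' S.L l
  closedL l := (S.closedL l).preimage he.continuous
  N s j := e ⁻¹' S.N s j
  openN s j := (S.openN s j).preimage he.continuous
  disj s i j h := (S.disj s i j h).preimage e
  FL := S.FL
  clos s := by
    rw [← preimage_iUnion]
    refine (he.continuous.closure_preimage_subset _).trans ?_
    refine (preimage_mono (S.clos s)).trans ?_
    simp only [preimage_union, preimage_iUnion]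
    exact subset_rfl
  base x U hU := by
    rw [he.nhds_eq_comap, Filter.mem_comap] at hU
    obtain ⟨W, hW, hWU⟩ := hU
    obtain ⟨s, j, h1, h2, h3⟩ := S.base (e x) W hW
    exact ⟨s, j, h1, (preimage_mono h2).trans hWU, h3⟩

theorem indZero_of_countable_cover {Z : Type*} [TopologicalSpace Z]
    (h : ∀ A B : Set Z, IsClosed A → IsClosed B → Disjoint A B → ∃ c : ℕ → Set Z,
      (∀ n, IsClopen (c n)) ∧ (⋃ n, c n) = univ ∧ ∀ n, Disjoint (c n) A ∨ Disjoint (c n) B) :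
    IndZero Z := by
  intro A B hA hB hAB
  obtain ⟨c, hc, hcu, hcd⟩ := h A B hA hB hAB
  have hd : ∀ n, IsOpen (disjointed c n) := by
    intro n
    rw [disjointed_eq_inter_compl]
    refine (hc n).isOpen.inter ?_
    have : (⋂ j < n, (c j)ᶜ) = ⋂ j ∈ Finset.range n, (c j)ᶜ := by simp
    rw [this]
    exact isOpen_biInter_finset fun j _ => (hc j).compl.isOpen
  have hcov : (⋃ n, disjointed c n) = univ := by rw [iUnion_disjointed, hcu]
  set P := ⋃ n ∈ {n | Disjoint (c n) B}, disjointed c n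
  have hPc : Pᶜ = ⋃ n ∈ {n | ¬ Disjoint (c n) B}, disjointed c n := by
    ext x
    constructor
    · intro hx
      obtain ⟨n, hn⟩ := mem_iUnion.1 (hcov ▸ mem_univ x)
      refine mem_biUnion (x := n) ?_ hn
      intro h'
      exact hx (mem_biUnion (x := n) h' hn)
    · intro hx hx'
      obtain ⟨n, hn, hn'⟩ := mem_iUnion₂.1 hx
      obtain ⟨m, hm, hm'⟩ := mem_iUnion₂.1 hx'
      have : n ≠ m := by rintro rfl; exact hn hm
      exact Set.disjoint_left.1 (disjoint_disjointed c this) hn' hm'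
  refine ⟨P, ⟨?_, ?_⟩, ?_, ?_⟩
  · rw [← isOpen_compl_iff, hPc]
    exact isOpen_biUnion fun n _ => hd n
  · exact isOpen_biUnion fun n _ => hd n
  · intro x hx
    by_contra hxP
    have : x ∈ Pᶜ := hxP
    rw [hPc] at this
    obtain ⟨n, hn, hn'⟩ := mem_iUnion₂.1 this
    rcases hcd n with h1 | h1
    · exact Set.disjoint_left.1 h1 (disjointed_subset c n hn') hx
    · exact hn h1
  · rw [Set.disjoint_left]
    intro x hx hxB
    obtain ⟨n, hn, hn'⟩ := mem_iUnion₂.1 hx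
    exact Set.disjoint_left.1 hn (disjointed_subset c n hn') hxB

theorem LStruct.indZero {Z Λ ι J : Type*} [TopologicalSpace Z] [Countable ι]
    (S : LStruct Z Λ ι J) (Sg : Set Λ) (hS : ∀ z, {l | z ∈ S.L l} = Sg) : IndZero Z := by
  apply indZero_of_countable_cover
  intro A B hA hB hAB
  have hmem : ∀ z l, z ∈ S.L l ↔ l ∈ Sg := by
    intro z l; rw [← hS z]; rfl
  have hclop : ∀ s, (∀ l ∈ S.FL s, l ∉ Sg) → ∀ G : Set J, IsClopen (⋃ j ∈ G, S.N s j) := by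
    intro s hs G
    have hcl : IsClosed (⋃ j, S.N s j) := by
      apply isClosed_of_closure_subset
      intro x hx
      rcases S.clos s hx with h | h
      · exact h
      · obtain ⟨l, hl, hxl⟩ := mem_iUnion₂.1 h
        exact absurd ((hmem x l).1 hxl) (hs l hl)
    refine ⟨?_, isOpen_biUnion fun j _ => S.openN s j⟩
    have : (⋃ j ∈ G, S.N s j) = (⋃ j, S.N s j) ∩ (⋃ j ∈ Gᶜ, S.N s j)ᶜ := by
      ext x
      constructor
      · intro hx
        obtain ⟨j, hj, hxj⟩ := mem_iUnion₂.1 hx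
        refine ⟨mem_iUnion.2 ⟨j, hxj⟩, ?_⟩
        intro hx'
        obtain ⟨i, hi, hxi⟩ := mem_iUnion₂.1 hx'
        have : i ≠ j := by rintro rfl; exact hi hj
        exact Set.disjoint_left.1 (S.disj s i j this) hxi hxj
      · rintro ⟨hx, hx'⟩
        obtain ⟨j, hj⟩ := mem_iUnion.1 hx
        by_cases hG : j ∈ G
        · exact mem_biUnion hG hj
        · exact absurd (mem_biUnion (x := j) hG hj) hx'
    rw [this]
    exact hcl.inter (isOpen_biUnion fun j _ => S.openN s j).isClosed_compl
  let K : Option (ι × Bool) → Set Z := fun o => match o with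
    | none => ∅
    | some (s, b) => ⋃ j ∈ {j | (∀ l ∈ S.FL s, l ∉ Sg) ∧ Disjoint (S.N s j) (cond b A B)}, S.N s j
  obtain ⟨e, he⟩ := exists_surjective_nat (Option (ι × Bool))
  refine ⟨fun n => K (e n), ?_, ?_, ?_⟩
  · intro n
    show IsClopen (K (e n))
    rcases e n with _ | ⟨s, b⟩
    · exact isClopen_empty
    · by_cases h : ∀ l ∈ S.FL s, l ∉ Sg
      · exact hclop s h _
      · have : K (some (s, b)) = ∅ := by
          simp only [K]
          ext x
          simp only [mem_iUnion, mem_ofPred_eq, mem_empty_iff_false, iff_false]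
          rintro ⟨j, ⟨h', _⟩, _⟩
          exact h h'
        rw [this]; exact isClopen_empty
  · rw [eq_univ_iff_forall]
    intro x
    have key : ∀ b : Bool, x ∉ cond b A B → x ∈ ⋃ n, K (e n) := by
      intro b hb
      have hcl : IsClosed (cond b A B) := by cases b <;> assumption
      obtain ⟨s, j, h1, h2, h3⟩ := S.base x _ (hcl.isOpen_compl.mem_nhds hb)
      obtain ⟨n, hn⟩ := he (some (s, b))
      refine mem_iUnion.2 ⟨n, ?_⟩
      rw [hn]
      refine mem_biUnion (x := j) ⟨?_, ?_⟩ h1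
      · intro l hl hl'
        exact h3 l hl ((hmem x l).2 hl')
      · exact Set.disjoint_left.2 fun y hy hy' => h2 hy hy'
    by_cases hx : x ∈ A
    · exact key false (Set.disjoint_left.1 hAB hx)
    · exact key true hx
  · intro n
    show Disjoint (K (e n)) A ∨ Disjoint (K (e n)) B
    rcases e n with _ | ⟨s, b⟩
    · left; exact empty_disjoint _
    · cases b
      · right
        simp only [K, disjoint_iUnion_left]
        exact fun j hj => hj.2
      · left
        simp only [K, disjoint_iUnion_left]
        exact fun j hj => hj.2

theorem indZero_sum_nat {Z : Type*} [TopologicalSpace Z] [NormalSpace Z] (C : ℕ → Set Z)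
    (hC : ∀ i, IsClosed (C i)) (hcov : (⋃ i, C i) = univ) (h0 : ∀ i, IndZero (C i)) :
    IndZero Z := by
  intro A B hA hB hAB
  -- separation of closed sets by open sets with disjoint closures
  have sep : ∀ A B : Set Z, IsClosed A → IsClosed B → Disjoint A B →
      ∃ U V, IsOpen U ∧ IsOpen V ∧ A ⊆ U ∧ B ⊆ V ∧ Disjoint (closure U) (closure V) := by
    intro A B hA hB hAB
    obtain ⟨U, hU, hAU, hUB⟩ := normal_exists_closure_subset hA hB.isOpen_compl
      (disjoint_left.1 hAB)
    obtain ⟨V, hV, hBV, hVU⟩ := normal_exists_closure_subset hB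
      (isClosed_closure (s := U)).isOpen_compl (fun x hx hx' => hUB hx' hx)
    exact ⟨U, V, hU, hV, hAU, hBV, disjoint_left.2 fun x hx hx' => hVU hx' hx⟩
  let St := {q : Set Z × Set Z // IsOpen q.1 ∧ IsOpen q.2 ∧ Disjoint (closure q.1) (closure q.2)}
  have step : ∀ (i : ℕ) (q : St), ∃ q' : St, q.1.1 ⊆ q'.1.1 ∧ q.1.2 ⊆ q'.1.2 ∧
      C i ⊆ q'.1.1 ∪ q'.1.2 := by
    rintro i ⟨⟨U, V⟩, hU, hV, hUV⟩
    obtain ⟨P, hP, hP1, hP2⟩ := h0 i (Subtype.val ⁻¹' closure U) (Subtype.val ⁻¹' closure V)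
      (isClosed_closure.preimage continuous_subtype_val)
      (isClosed_closure.preimage continuous_subtype_val) (hUV.preimage _)
    have e1 := (hC i).isClosedEmbedding_subtypeVal.isClosedMap P hP.isClosed
    have e2 := (hC i).isClosedEmbedding_subtypeVal.isClosedMap Pᶜ hP.compl.isClosed
    obtain ⟨U', V', h1, h2, h3, h4, h5⟩ := sep (closure U ∪ Subtype.val '' P)
      (closure V ∪ Subtype.val '' Pᶜ) (isClosed_closure.union e1) (isClosed_closure.union e2) (by
        rw [disjoint_left]
        rintro x (hx | ⟨y, hy, rfl⟩) (hx' | ⟨z, hz, hzx⟩)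
        · exact disjoint_left.1 hUV hx hx'
        · subst hzx; exact hz (hP1 hx)
        · exact disjoint_left.1 hP2 hy hx'
        · exact hz (Subtype.ext hzx ▸ hy))
    refine ⟨⟨(U', V'), h1, h2, h5⟩, ?_, ?_, ?_⟩
    · exact subset_closure.trans (subset_union_left.trans h3)
    · exact subset_closure.trans (subset_union_left.trans h4)
    · intro x hx
      by_cases hxP : (⟨x, hx⟩ : C i) ∈ P
      · left; exact h3 (Or.inr ⟨_, hxP, rfl⟩)
      · right; exact h4 (Or.inr ⟨_, hxP, rfl⟩)
  choose nx hn1 hn2 hn3 using step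
  obtain ⟨U, V, hU, hV, hAU, hBV, hUV⟩ := sep A B hA hB hAB
  let q : ℕ → St := fun n => Nat.rec ⟨(U, V), hU, hV, hUV⟩ (fun i q => nx i q) n
  have hq : ∀ n, q (n+1) = nx n (q n) := fun n => rfl
  have m1 : Monotone fun n => (q n).1.1 := monotone_nat_of_le_succ fun n => hn1 n (q n)
  have m2 : Monotone fun n => (q n).1.2 := monotone_nat_of_le_succ fun n => hn2 n (q n)
  have hdis : Disjoint (⋃ n, (q n).1.1) (⋃ n, (q n).1.2) := by
    rw [disjoint_left]
    intro x hx hx'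
    obtain ⟨n, hn⟩ := mem_iUnion.1 hx
    obtain ⟨m, hm⟩ := mem_iUnion.1 hx'
    exact disjoint_left.1 (q (max n m)).2.2.2 (subset_closure (m1 (le_max_left n m) hn))
      (subset_closure (m2 (le_max_right n m) hm))
  have huniv : (⋃ n, (q n).1.1) ∪ (⋃ n, (q n).1.2) = univ := by
    rw [eq_univ_iff_forall]
    intro x
    obtain ⟨i, hi⟩ := mem_iUnion.1 (hcov ▸ mem_univ x)
    rcases hn3 i (q i) hi with h | h
    · left; exact mem_iUnion.2 ⟨i+1, h⟩
    · right; exact mem_iUnion.2 ⟨i+1, h⟩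
  refine ⟨⋃ n, (q n).1.1, ⟨?_, ?_⟩, ?_, ?_⟩
  · have : (⋃ n, (q n).1.1) = (⋃ n, (q n).1.2)ᶜ := by
      ext x
      constructor
      · exact fun hx => disjoint_left.1 hdis hx
      · intro hx
        exact ((huniv ▸ mem_univ x : x ∈ (⋃ n, (q n).1.1) ∪ (⋃ n, (q n).1.2))).resolve_right hx
    rw [this]
    exact (isOpen_iUnion fun n => (q n).2.2.1).isClosed_compl
  · exact isOpen_iUnion fun n => (q n).2.1
  · exact fun x hx => mem_iUnion.2 ⟨0, hAU hx⟩
  · exact hdis.mono_right fun x hx => mem_iUnion.2 ⟨0, hBV hx⟩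

theorem indZero_sum {Z I : Type*} [Countable I] [TopologicalSpace Z] [NormalSpace Z] (C : I → Set Z)
    (hC : ∀ i, IsClosed (C i)) (hcov : (⋃ i, C i) = univ) (h0 : ∀ i, IndZero (C i)) :
    IndZero Z := by
  obtain ⟨e, he⟩ := exists_surjective_nat (Option I)
  let C' : Option I → Set Z := fun o => match o with
    | none => ∅
    | some i => C i
  refine indZero_sum_nat (fun n => C' (e n)) ?_ ?_ ?_
  · intro n
    rcases e n with _ | i
    · exact isClosed_empty
    · exact hC i
  · rw [eq_univ_iff_forall] at hcov ⊢
    intro x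
    obtain ⟨i, hi⟩ := mem_iUnion.1 (hcov x)
    obtain ⟨n, hn⟩ := he (some i)
    exact mem_iUnion.2 ⟨n, by rw [hn]; exact hi⟩
  · intro n
    show IndZero (C' (e n))
    rcases e n with _ | i
    · intro A B _ _ _
      have : IsEmpty (C' none) := ⟨fun x => x.2⟩
      exact ⟨∅, isClopen_empty, fun x _ => (this.false x).elim, empty_disjoint _⟩
    · exact h0 i

theorem IndZero.refine {Z : Type*} [TopologicalSpace Z] [T2Space Z] [ParacompactSpace Z]
    (h0 : IndZero Z) {ι : Type*} (U : ι → Set Z) (hU : ∀ i, IsOpen (U i)) (hc : (⋃ i, U i) = univ) :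
    ∃ V : ι → Set Z, (∀ i, IsOpen (V i)) ∧ (∀ i j, i ≠ j → Disjoint (V i) (V j)) ∧
      (∀ i, V i ⊆ U i) ∧ (⋃ i, V i) = univ := by
  obtain ⟨V, hVo, hVc, hVl, hVU⟩ := precise_refinement U hU hc
  obtain ⟨W, hWc, hWo, hWV⟩ := exists_iUnion_eq_closure_subset hVo
    (fun x => hVl.point_finite x) hVc
  have := fun i => h0 (closure (W i)) (V i)ᶜ isClosed_closure (hVo i).isClosed_compl
    (disjoint_left.2 fun x hx hx' => hx' (hWV i hx))
  choose K hK hK1 hK2 using this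
  have hKV : ∀ i, K i ⊆ V i := fun i x hx => by
    by_contra hx'; exact disjoint_left.1 (hK2 i) hx hx'
  have hKl : LocallyFinite K := hVl.subset hKV
  let : LinearOrder ι := IsWellOrder.linearOrder WellOrderingRel
  have hwf : WellFounded ((· < ·) : ι → ι → Prop) := (inferInstance : IsWellOrder ι WellOrderingRel).wf
  refine ⟨fun i => K i \ ⋃ b : {b // b < i}, K b, ?_, ?_, ?_, ?_⟩
  · intro i
    refine (hK i).isOpen.sdiff ?_
    exact (hKl.comp_injective Subtype.val_injective).isClosed_iUnion fun b => (hK b).isClosed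
  · have : ∀ i j, i < j → Disjoint (K i \ ⋃ b : {b // b < i}, K b) (K j \ ⋃ b : {b // b < j}, K b) := by
      intro i j hij
      rw [disjoint_left]
      rintro x ⟨hx, _⟩ ⟨_, hx'⟩
      exact hx' (mem_iUnion.2 ⟨⟨i, hij⟩, hx⟩)
    intro i j hij
    rcases lt_or_gt_of_ne hij with h | h
    · exact this i j h
    · exact (this j i h).symm
  · exact fun i => sdiff_subset.trans ((hKV i).trans (hVU i))
  · rw [eq_univ_iff_forall]
    intro x
    obtain ⟨i0, hi0⟩ := mem_iUnion.1 (hWc ▸ mem_univ x)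
    have hne : {i | x ∈ K i}.Nonempty := ⟨i0, hK1 i0 (subset_closure hi0)⟩
    refine mem_iUnion.2 ⟨hwf.min _ hne, hwf.min_mem _ hne, ?_⟩
    intro hx
    obtain ⟨⟨b, hb⟩, hxb⟩ := mem_iUnion.1 hx
    exact hwf.not_lt_min _ hxb hb

theorem pZero_of_indZero {T : Type*} [TopologicalSpace T] [TopologicalSpace.MetrizableSpace T]
    (E : Set T) (h0 : IndZero E) : PZero E := by
  let := TopologicalSpace.metrizableSpaceMetric T
  intro ι U hU hc
  obtain ⟨V, hVo, hVd, hVU, hVc⟩ := h0.refine (fun i => (Subtype.val ⁻¹' U i : Set E))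
    (fun i => (hU i).preimage continuous_subtype_val) (by
      rw [← preimage_iUnion, eq_univ_iff_forall]
      exact fun x => hc x.2)
  let M : ι → Set T := fun i => {t | infEDist t (Subtype.val '' V i) < infEDist t (Subtype.val '' (V i)ᶜ)}
  refine ⟨fun i => M i ∩ U i, ?_, ?_, fun i => inter_subset_right, ?_⟩
  · exact fun i => (isOpen_lt continuous_infEDist continuous_infEDist).inter (hU i)
  · intro i j hij
    rw [disjoint_left]
    rintro t ⟨h1, _⟩ ⟨h2, _⟩
    have s1 : V j ⊆ (V i)ᶜ := fun x hx hx' => disjoint_left.1 (hVd i j hij) hx' hx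
    have s2 : V i ⊆ (V j)ᶜ := fun x hx hx' => disjoint_left.1 (hVd i j hij) hx hx'
    have a1 : infEDist t (Subtype.val '' (V i)ᶜ) ≤ infEDist t (Subtype.val '' (V j)) :=
      infEDist_anti (image_mono s1)
    have a2 : infEDist t (Subtype.val '' (V j)ᶜ) ≤ infEDist t (Subtype.val '' (V i)) :=
      infEDist_anti (image_mono s2)
    exact lt_irrefl _ ((h1.trans_le a1).trans (h2.trans_le a2))
  · intro x hx
    obtain ⟨i, hi⟩ := mem_iUnion.1 (hVc ▸ mem_univ (⟨x, hx⟩ : E))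
    refine mem_iUnion.2 ⟨i, ?_, hVU i hi⟩
    show infEDist x (Subtype.val '' V i) < infEDist x (Subtype.val '' (V i)ᶜ)
    rw [infEDist_zero_of_mem (show x ∈ Subtype.val '' V i from ⟨_, hi, rfl⟩), pos_iff_ne_zero, Ne, ← mem_closure_iff_infEDist_zero]
    intro hcl
    have : (⟨x, hx⟩ : E) ∈ closure ((V i)ᶜ) := by
      rw [closure_subtype]; exact hcl
    rw [(hVo i).isClosed_compl.closure_eq] at this
    exact this hi

theorem LStruct.pZero_stratum {T Λ ι J : Type*} [TopologicalSpace T]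
    [TopologicalSpace.MetrizableSpace T] [Countable ι] [Countable Λ]
    (S : LStruct T Λ ι J) (c : ℕ) : PZero {z | {l | z ∈ S.L l}.encard = c} := by
  apply pZero_of_indZero
  set E := {z | {l | z ∈ S.L l}.encard = c}
  let C : {s : Finset Λ // s.card = c} → Set E := fun s => {z | ∀ l ∈ s.1, z.1 ∈ S.L l}
  refine indZero_sum C ?_ ?_ ?_
  · intro s
    have : C s = ⋂ l ∈ s.1, Subtype.val ⁻¹' S.L l := by ext z; simp [C]
    rw [this]
    exact isClosed_biInter fun l _ => (S.closedL l).preimage continuous_subtype_val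
  · rw [eq_univ_iff_forall]
    intro z
    have hz : {l | z.1 ∈ S.L l}.encard = c := z.2
    have hf : {l | z.1 ∈ S.L l}.Finite := finite_of_encard_eq_coe hz
    refine mem_iUnion.2 ⟨⟨hf.toFinset, ?_⟩, ?_⟩
    · rw [hf.encard_eq_coe_toFinset_card] at hz
      exact_mod_cast hz
    · intro l hl
      simpa using hl
  · intro s
    refine (S.comap (fun z : C s => z.1.1)
      (IsInducing.subtypeVal.comp IsInducing.subtypeVal)).indZero (s.1 : Set Λ) ?_
    intro z
    show {l | z.1.1 ∈ S.L l} = s.1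
    have hz : {l | z.1.1 ∈ S.L l}.encard = c := z.1.2
    refine ((finite_of_encard_eq_coe hz).eq_of_subset_of_encard_le'
      (show (s.1 : Set Λ) ⊆ _ from fun l hl => z.2 l hl) ?_).symm
    rw [hz, encard_coe_eq_coe_finsetCard, s.2]

theorem LStruct.covDim {T Λ ι J : Type*} [TopologicalSpace T]
    [TopologicalSpace.MetrizableSpace T] [Countable ι] [Countable Λ]
    (S : LStruct T Λ ι J) (d : ℕ) (h : ∀ z, {l | z ∈ S.L l}.encard ≤ d) : CovDimLENat T d := by
  intro 𝒰 _ hUo hUc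
  have : ∀ c : Fin (d+1), ∃ V : 𝒰 → Set T, (∀ i, IsOpen (V i)) ∧ (∀ i j, i ≠ j → Disjoint (V i) (V j)) ∧
      (∀ i, V i ⊆ i.1) ∧ {z | {l | z ∈ S.L l}.encard = (c : ℕ)} ⊆ ⋃ i, V i := fun c =>
    S.pZero_stratum c 𝒰 (fun u => u.1) (fun u => hUo u.1 u.2) (by
      rw [← sUnion_eq_iUnion, hUc]; exact subset_univ _)
  choose V hVo hVd hVU hVc using this
  refine ⟨{W | ∃ c i, W = V c i}, ?_, ?_, ?_, ?_⟩
  · rintro W ⟨c, i, rfl⟩; exact hVo c i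
  · rw [eq_univ_iff_forall]
    intro x
    have hx := h x
    obtain ⟨c, hc⟩ := ENat.ne_top_iff_exists.1 (ne_top_of_le_ne_top (ENat.natCast_ne_top d) hx)
    rw [← hc] at hx
    have hcd : c < d + 1 := by
      have : c ≤ d := by exact_mod_cast hx
      omega
    obtain ⟨i, hi⟩ := mem_iUnion.1 (hVc ⟨c, hcd⟩ (show _ = _ from hc.symm))
    exact ⟨_, ⟨_, _, rfl⟩, hi⟩
  · rintro W ⟨c, i, rfl⟩; exact ⟨i, i.2, hVU c i⟩
  · intro x
    classical
    let G : Fin (d+1) → Set T := fun c => if h : ∃ i, x ∈ V c i then V c h.choose else ∅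
    have hsub : {W ∈ {W | ∃ c i, W = V c i} | x ∈ W} ⊆ G '' univ := by
      rintro W ⟨⟨c, i, rfl⟩, hx⟩
      refine ⟨c, mem_univ _, ?_⟩
      have hex : ∃ i, x ∈ V c i := ⟨i, hx⟩
      simp only [G, dif_pos hex]
      by_contra hne
      have hne' : hex.choose ≠ i := fun h => hne (by rw [h])
      exact disjoint_left.1 (hVd c _ _ hne') hex.choose_spec hx
    have hfin : (G '' univ).Finite := finite_univ.image G
    refine ⟨hfin.subset hsub, (ncard_le_ncard hsub hfin).trans ((ncard_image_le finite_univ).trans ?_)⟩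
    simp [ncard_univ]

/-- barycentric coordinates from affine ones -/
noncomputable def baryOf {k : ℕ} (θ : Fin k → ℝ) : Fin (k+1) → ℝ := Fin.cons (1 - ∑ j, θ j) θ

theorem baryOf_contDiff {k : ℕ} (j : Fin (k+1)) : ContDiff ℝ 1 (fun θ : Fin k → ℝ => baryOf θ j) := by
  refine Fin.cases ?_ (fun i => ?_) j
  · simp only [baryOf, Fin.cons_zero]
    fun_prop
  · simp only [baryOf, Fin.cons_succ]
    fun_prop

theorem baryOf_tail {k : ℕ} (lam : Fin (k+1) → ℝ) (h : ∑ j, lam j = 1) :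
    baryOf (fun j : Fin k => lam j.succ) = lam := by
  funext j
  refine Fin.cases ?_ (fun i => ?_) j
  · simp only [baryOf, Fin.cons_zero]
    rw [Fin.sum_univ_succ] at h
    linarith
  · simp only [baryOf, Fin.cons_succ]

theorem contDiff_euclid {p : ℕ} {V : Type*} [NormedAddCommGroup V] [NormedSpace ℝ V]
    {f : V → EuclideanSpace ℝ (Fin p)} (h : ∀ c, ContDiff ℝ 1 (fun x => f x c)) : ContDiff ℝ 1 f :=
  contDiff_euclidean.2 h

/-- The set of bad vertex perturbations for one configuration. -/
def BadSet {ι : Type*} {n k r p : ℕ} (S : Finset (Fin p)) (q : Fin p → ℝ)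
    (w : ι → (Fin r → ℝ) → EuclideanSpace ℝ (Fin p)) (v : Fin n → Fin (k+1) → ι) :
    Set (ι → EuclideanSpace ℝ (Fin p)) :=
  {s | ∃ t ∈ Icc (0 : Fin r → ℝ) 1, ∃ lam : Fin n → Fin (k+1) → ℝ, (∀ l j, 0 ≤ lam l j) ∧
    (∀ l, ∑ j, lam l j = 1) ∧ ∃ z : EuclideanSpace ℝ (Fin p), (∀ c ∈ S, z c = q c) ∧
    ∀ l, ∑ j, lam l j • (w (v l j) t + s (v l j)) = z}

theorem badSet_closed {ι : Type*} [Fintype ι] {n k r p : ℕ} (hn : 0 < n) (S : Finset (Fin p)) (q : Fin p → ℝ)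
    (w : ι → (Fin r → ℝ) → EuclideanSpace ℝ (Fin p)) (hw : ∀ a, Continuous (w a))
    (v : Fin n → Fin (k+1) → ι) : IsClosed (BadSet S q w v) := by
  let l0 : Fin n := ⟨0, hn⟩
  let K : Set ((Fin r → ℝ) × (Fin n → Fin (k+1) → ℝ)) :=
    Icc (0 : Fin r → ℝ) 1 ×ˢ {lam | (∀ l j, 0 ≤ lam l j) ∧ (∀ l, ∑ j, lam l j = 1)}
  have hK : IsCompact K := by
    refine isCompact_Icc.prod ?_
    have hsub : {lam : Fin n → Fin (k+1) → ℝ | (∀ l j, 0 ≤ lam l j) ∧ (∀ l, ∑ j, lam l j = 1)}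
        ⊆ Icc 0 1 := by
      rintro lam ⟨h1, h2⟩
      refine ⟨fun l j => h1 l j, fun l j => ?_⟩
      have := Finset.single_le_sum (f := lam l) (fun i _ => h1 l i) (Finset.mem_univ j)
      rw [h2 l] at this
      exact this
    refine isCompact_Icc.of_isClosed_subset ?_ hsub
    apply IsClosed.inter
    · show IsClosed {lam : Fin n → Fin (k+1) → ℝ | ∀ l j, 0 ≤ lam l j}
      simp only [setOf_forall]
      exact isClosed_iInter fun l => isClosed_iInter fun j =>
        isClosed_le continuous_const (by fun_prop)
    · show IsClosed {lam : Fin n → Fin (k+1) → ℝ | ∀ l, ∑ j, lam l j = 1}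
      simp only [setOf_forall]
      exact isClosed_iInter fun l => isClosed_eq (by fun_prop) continuous_const
  haveI : CompactSpace K := isCompact_iff_compactSpace.1 hK
  let F : Fin n → ((ι → EuclideanSpace ℝ (Fin p)) × K) → EuclideanSpace ℝ (Fin p) :=
    fun l x => ∑ j, x.2.1.2 l j • (w (v l j) x.2.1.1 + x.1 (v l j))
  have hF : ∀ l, Continuous (F l) := by
    intro l
    refine continuous_finset_sum _ fun j _ => ?_
    have := hw (v l j)
    fun_prop
  let C : Set ((ι → EuclideanSpace ℝ (Fin p)) × K) :=
    {x | (∀ l, F l x = F l0 x) ∧ ∀ c ∈ S, F l0 x c = q c}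
  have hC : IsClosed C := by
    apply IsClosed.inter
    · show IsClosed {x | ∀ l, F l x = F l0 x}
      simp only [setOf_forall]
      exact isClosed_iInter fun l => isClosed_eq (hF l) (hF l0)
    · show IsClosed {x | ∀ c ∈ S, F l0 x c = q c}
      simp only [setOf_forall]
      have h0 := hF l0
      exact isClosed_iInter fun c => isClosed_iInter fun _ => isClosed_eq (by fun_prop) continuous_const
  have : BadSet S q w v = Prod.fst '' C := by
    ext s
    constructor
    · rintro ⟨t, ht, lam, h1, h2, z, hz, h3⟩
      refine ⟨(s, ⟨(t, lam), ht, h1, h2⟩), ⟨fun l => ?_, fun c hc => ?_⟩, rfl⟩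
      · show ∑ j, lam l j • (w (v l j) t + s (v l j)) = ∑ j, lam l0 j • (w (v l0 j) t + s (v l0 j))
        rw [h3, h3]
      · show (∑ j, lam l0 j • (w (v l0 j) t + s (v l0 j))) c = q c
        rw [h3, hz c hc]
    · rintro ⟨⟨s', ⟨⟨t, lam⟩, ht, h1, h2⟩⟩, ⟨h3, h4⟩, rfl⟩
      exact ⟨t, ht, lam, h1, h2, _, h4, h3⟩
  rw [this]
  exact isClosedMap_fst_of_compactSpace _ hC

theorem badSet_dense {ι : Type*} [Fintype ι] {n k r p : ℕ} (S : Finset (Fin p)) (q : Fin p → ℝ)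
    (hdim : r + n * k + (p - S.card) < n * p)
    (w : ι → (Fin r → ℝ) → EuclideanSpace ℝ (Fin p)) (hw : ∀ a, ContDiff ℝ 1 (w a))
    (v : Fin n → Fin (k+1) → ι) (hv : ∀ l l', l ≠ l' → ∀ j j', v l j ≠ v l' j') :
    Dense (BadSet S q w v)ᶜ := by
  classical
  rw [Metric.dense_iff]
  intro s0 ε hε
  let zf : ({c // c ∉ S} → ℝ) → EuclideanSpace ℝ (Fin p) := fun z =>
    WithLp.toLp 2 (fun c => if h : c ∈ S then q c else z ⟨c, h⟩)
  have hzf : ContDiff ℝ 1 zf := by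
    apply contDiff_euclid
    intro c
    by_cases h : c ∈ S
    · simp only [zf, dif_pos h]; exact contDiff_const
    · simp only [zf, dif_neg h]; fun_prop
  let Φ : (Fin r → ℝ) × (Fin n → Fin k → ℝ) × ({c // c ∉ S} → ℝ) → (Fin n → EuclideanSpace ℝ (Fin p)) :=
    fun x l => zf x.2.2 - ∑ j, baryOf (x.2.1 l) j • (w (v l j) x.1 + s0 (v l j))
  have hΦ : ContDiff ℝ 1 Φ := by
    rw [contDiff_pi]
    intro l
    refine ContDiff.sub (hzf.comp (by fun_prop)) ?_
    refine ContDiff.sum fun j _ => ?_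
    have e1 : ContDiff ℝ 1 (fun x : (Fin r → ℝ) × (Fin n → Fin k → ℝ) × ({c // c ∉ S} → ℝ) =>
        baryOf (x.2.1 l) j) := (baryOf_contDiff j).comp (by fun_prop)
    have e2 : ContDiff ℝ 1 (fun x : (Fin r → ℝ) × (Fin n → Fin k → ℝ) × ({c // c ∉ S} → ℝ) =>
        w (v l j) x.1 + s0 (v l j)) := ((hw (v l j)).comp (by fun_prop)).add contDiff_const
    exact e1.smul e2
  have hfr : Module.finrank ℝ ((Fin r → ℝ) × (Fin n → Fin k → ℝ) × ({c // c ∉ S} → ℝ)) <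
      Module.finrank ℝ (Fin n → EuclideanSpace ℝ (Fin p)) := by
    have hcard : Fintype.card {c // c ∉ S} = p - S.card := by
      rw [Fintype.card_subtype_compl]; simp
    simp only [Module.finrank_prod, Module.finrank_pi, Module.finrank_pi_fintype, finrank_euclideanSpace,
      Fintype.card_fin, Finset.sum_const, Finset.card_univ, smul_eq_mul, hcard]
    omega
  have hd := hΦ.dense_compl_range_of_finrank_lt_finrank hfr
  obtain ⟨σ, hσ1, hσ2⟩ := Metric.dense_iff.1 hd 0 ε hε
  rw [mem_ball_zero_iff, pi_norm_lt_iff hε] at hσ1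
  let s : ι → EuclideanSpace ℝ (Fin p) := fun a => s0 a + (if h : ∃ l j, v l j = a then σ h.choose else 0)
  have hs : ∀ l j, s (v l j) = s0 (v l j) + σ l := by
    intro l j
    have hex : ∃ l' j', v l' j' = v l j := ⟨l, j, rfl⟩
    simp only [s, dif_pos hex]
    congr 2
    obtain ⟨j', hj'⟩ := hex.choose_spec
    by_contra hne
    exact hv _ _ hne j' j hj'
  refine ⟨s, ?_, ?_⟩
  · rw [mem_ball, dist_pi_lt_iff hε]
    intro a
    rw [dist_eq_norm]
    simp only [s, add_sub_cancel_left]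
    split_ifs with h
    · exact hσ1 _
    · simpa using hε
  · rintro ⟨t, ht, lam, h1, h2, z, hz, h3⟩
    apply hσ2
    refine ⟨(t, fun l j => lam l j.succ, fun c => z c), ?_⟩
    funext l
    have hz' : zf (fun c => z c) = z := by
      ext c
      by_cases h : c ∈ S
      · simp only [zf, dif_pos h, hz c h]
      · simp only [zf, dif_neg h]
    simp only [Φ, hz', baryOf_tail (lam l) (h2 l)]
    rw [← h3 l]
    simp only [hs, smul_add, Finset.sum_add_distrib]
    rw [← Finset.sum_smul, h2 l, one_smul]
    abel

theorem genpos {ι : Type*} [Fintype ι] {n k r p : ℕ} (S : Finset (Fin p)) (q : Fin p → ℝ)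
    (hdim : r + n * k + (p - S.card) < n * p)
    (w : ι → (Fin r → ℝ) → EuclideanSpace ℝ (Fin p)) (hw : ∀ a, ContDiff ℝ 1 (w a))
    (δ : ℝ) (hδ : 0 < δ) :
    ∃ s : ι → EuclideanSpace ℝ (Fin p), (∀ a, ‖s a‖ < δ) ∧
      ∀ v : Fin n → Fin (k+1) → ι, (∀ l l', l ≠ l' → ∀ j j', v l j ≠ v l' j') → s ∉ BadSet S q w v := by
  have hn : 0 < n := by
    rcases Nat.eq_zero_or_pos n with h | h
    · subst h; simp at hdim
    · exact h
  have hd : Dense (⋂ v : {v : Fin n → Fin (k+1) → ι // ∀ l l', l ≠ l' → ∀ j j', v l j ≠ v l' j'},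
      (BadSet S q w v.1)ᶜ) := by
    apply dense_iInter_of_isOpen
    · exact fun v => (badSet_closed hn S q w (fun a => (hw a).continuous) v.1).isOpen_compl
    · exact fun v => badSet_dense S q hdim w hw v.1 v.2
  obtain ⟨s, hs1, hs2⟩ := Metric.dense_iff.1 hd 0 δ hδ
  rw [mem_ball_zero_iff, pi_norm_lt_iff hδ] at hs1
  exact ⟨s, hs1, fun v hv => mem_iInter.1 hs2 ⟨v, hv⟩⟩

theorem CovDimLENat.finite_refine {Y : Type*} [TopologicalSpace Y] {m : ℕ} (h : CovDimLENat Y m)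
    {ι : Type*} [Fintype ι] (U : ι → Set Y) (hU : ∀ i, IsOpen (U i)) (hc : (⋃ i, U i) = univ) :
    ∃ V : ι → Set Y, (∀ i, IsOpen (V i)) ∧ (∀ i, V i ⊆ U i) ∧ (⋃ i, V i) = univ ∧
      ∀ x, {i | x ∈ V i}.ncard ≤ m + 1 := by
  obtain ⟨𝒱, h1, h2, h3, h4⟩ := h (range U) (finite_range U) (by rintro _ ⟨i, rfl⟩; exact hU i)
    (by rw [sUnion_range, hc])
  have : ∀ V : 𝒱, ∃ i, V.1 ⊆ U i := by
    rintro ⟨V, hV⟩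
    obtain ⟨_, ⟨i, rfl⟩, hi⟩ := h3 V hV
    exact ⟨i, hi⟩
  choose c hcc using this
  refine ⟨fun i => ⋃ V : {V : 𝒱 // c V = i}, V.1.1, ?_, ?_, ?_, ?_⟩
  · exact fun i => isOpen_iUnion fun V => h1 _ V.1.2
  · intro i
    refine iUnion_subset ?_
    rintro ⟨V, rfl⟩
    exact hcc V
  · rw [eq_univ_iff_forall] at h2 ⊢
    intro x
    obtain ⟨V, hV, hx⟩ := h2 x
    exact mem_iUnion.2 ⟨c ⟨V, hV⟩, mem_iUnion.2 ⟨⟨⟨V, hV⟩, rfl⟩, hx⟩⟩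
  · intro x
    obtain ⟨hf, hn⟩ := h4 x
    refine le_trans ?_ hn
    have hsub : {i | x ∈ ⋃ V : {V : 𝒱 // c V = i}, V.1.1} ⊆
        (fun V : {V ∈ 𝒱 | x ∈ V} => c ⟨V.1, V.2.1⟩) '' univ := by
      rintro i hi
      obtain ⟨⟨V, rfl⟩, hV⟩ := mem_iUnion.1 hi
      exact ⟨⟨V.1, V.2, hV⟩, mem_univ _, rfl⟩
    haveI : Finite {V ∈ 𝒱 | x ∈ V} := hf
    refine (ncard_le_ncard hsub (finite_univ.image _)).trans ((ncard_image_le finite_univ).trans ?_)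
    rw [ncard_univ]; rfl

theorem exists_pou {X ι : Type*} [TopologicalSpace X] [NormalSpace X] [Fintype ι] (V : ι → Set X)
    (hV : ∀ i, IsOpen (V i)) (hc : (⋃ i, V i) = univ) :
    ∃ ρ : ι → C(X, ℝ), (∀ i x, 0 ≤ ρ i x) ∧ (∀ x, ∑ i, ρ i x = 1) ∧ ∀ i x, ρ i x ≠ 0 → x ∈ V i := by
  obtain ⟨ρ, hρ⟩ := PartitionOfUnity.exists_isSubordinate_of_locallyFinite isClosed_univ V hV
    (locallyFinite_of_finite V) (by rw [hc])
  refine ⟨fun i => ρ i, fun i x => ρ.nonneg i x, fun x => ?_, fun i x hx => ?_⟩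
  · rw [← finsum_eq_sum_of_fintype]
    exact ρ.sum_eq_one (mem_univ x)
  · exact hρ i (subset_tsupport _ hx)

theorem bary_repr {ι : Type*} [Fintype ι] {k : ℕ} (ρ : ι → ℝ) (h0 : ∀ i, 0 ≤ ρ i) (h1 : ∑ i, ρ i = 1)
    (hc : {i | ρ i ≠ 0}.ncard ≤ k + 1) :
    ∃ (v : Fin (k+1) → ι) (lam : Fin (k+1) → ℝ), (∀ j, 0 ≤ lam j) ∧ (∑ j, lam j = 1) ∧
      (∀ j, ρ (v j) ≠ 0) ∧ ∀ {E : Type} [AddCommGroup E] [Module ℝ E] (u : ι → E),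
        ∑ i, ρ i • u i = ∑ j, lam j • u (v j) := by
  classical
  let F := {i // ρ i ≠ 0}
  have hcard : Fintype.card F ≤ Fintype.card (Fin (k+1)) := by
    rw [Fintype.card_fin]
    refine le_trans (le_of_eq ?_) hc
    rw [← Nat.card_eq_fintype_card]; rfl
  obtain ⟨h⟩ := Function.Embedding.nonempty_of_card_le hcard
  have hne : Nonempty F := by
    by_contra hcon
    have : ∀ i, ρ i = 0 := fun i => by
      by_contra hi; exact hcon ⟨⟨i, hi⟩⟩
    simp [this] at h1
  let g : Fin (k+1) → F := Function.invFun h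
  have hg : ∀ a, g (h a) = a := Function.leftInverse_invFun h.injective
  have key : ∀ {E : Type} [AddCommGroup E] [Module ℝ E] (u : ι → E),
        ∑ i, ρ i • u i = ∑ j, (if h (g j) = j then ρ (g j).1 else 0) • u (g j).1 := by
    intro E _ _ u
    have e1 : ∑ i, ρ i • u i = ∑ a : F, ρ a.1 • u a.1 := by
      have := Finset.sum_subtype_of_mem (p := fun i => ρ i ≠ 0) (s := Finset.univ.filter fun i => ρ i ≠ 0)
        (fun i => ρ i • u i) (by simp)
      rw [Finset.sum_filter_of_ne] at this
      · rw [← this]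
        apply Finset.sum_congr _ (fun _ _ => rfl)
        ext a; simp [a.2]
      · intro i _ hi hi'
        simp [hi'] at hi
    rw [e1]
    refine Finset.sum_of_injOn h h.injective.injOn (by simp) ?_ ?_
    · intro j _ hj
      rw [if_neg, zero_smul]
      intro hj'
      exact hj ⟨g j, by simp, hj'⟩
    · intro a _
      simp [hg]
  refine ⟨fun j => (g j).1, fun j => if h (g j) = j then ρ (g j).1 else 0, ?_, ?_, ?_, key⟩
  · intro j; dsimp only; split_ifs
    · exact h0 _
    · exact le_rfl
  · have := key (E := ℝ) (fun _ => 1)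
    simp only [smul_eq_mul, mul_one] at this
    rw [← this, h1]
  · exact fun j => (g j).2

theorem pou_dist {ι : Type*} [Fintype ι] {E : Type*} [NormedAddCommGroup E] [NormedSpace ℝ E]
    (ρ : ι → ℝ) (h0 : ∀ i, 0 ≤ ρ i) (h1 : ∑ i, ρ i = 1) (u : ι → E) (x : E) (δ : ℝ)
    (hu : ∀ i, ρ i ≠ 0 → dist (u i) x ≤ δ) : dist (∑ i, ρ i • u i) x ≤ δ := by
  have : (∑ i, ρ i • u i) - x = ∑ i, ρ i • (u i - x) := by
    simp only [smul_sub, Finset.sum_sub_distrib, ← Finset.sum_smul, h1, one_smul]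
  rw [dist_eq_norm, this]
  refine (norm_sum_le _ _).trans ?_
  calc ∑ i, ‖ρ i • (u i - x)‖ ≤ ∑ i, ρ i * δ := by
        refine Finset.sum_le_sum fun i _ => ?_
        rw [norm_smul, Real.norm_of_nonneg (h0 i)]
        by_cases hi : ρ i = 0
        · simp [hi]
        · refine mul_le_mul_of_nonneg_left ?_ (h0 i)
          rw [← dist_eq_norm]; exact hu i hi
    _ = δ := by rw [← Finset.sum_mul, h1, one_mul]

theorem lemmaU {Y : Type*} [TopologicalSpace Y] [NormalSpace Y] {m : ℕ} (h : CovDimLENat Y m)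
    (φ : Y →ᵇ EuclideanSpace ℝ (Fin (m+1))) (q : EuclideanSpace ℝ (Fin (m+1))) (δ : ℝ) (hδ : 0 < δ) :
    ∃ ψ : Y →ᵇ EuclideanSpace ℝ (Fin (m+1)), (∀ y, dist (ψ y) (φ y) ≤ δ) ∧
      ∃ η > 0, ∀ y, η ≤ dist (ψ y) q := by
  have htb : TotallyBounded (range φ) :=
    (φ.isBounded_range.isCompact_closure.totallyBounded).subset subset_closure
  obtain ⟨t, htf, ht⟩ := Metric.totallyBounded_iff.1 htb (δ/2) (by positivity)
  haveI : Fintype t := htf.fintype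
  obtain ⟨V, hVo, hVU, hVc, hVn⟩ := h.finite_refine (fun a : t => φ ⁻¹' ball a.1 (δ/2))
    (fun a => isOpen_ball.preimage φ.continuous) (by
      rw [eq_univ_iff_forall]
      intro y
      obtain ⟨a, ha, hy⟩ := mem_iUnion₂.1 (ht (mem_range_self y))
      exact mem_iUnion.2 ⟨⟨a, ha⟩, hy⟩)
  obtain ⟨ρ, hρ0, hρ1, hρV⟩ := exists_pou V hVo hVc
  obtain ⟨s, hs, hsv⟩ := genpos (ι := t) (n := 1) (k := m) (r := 0) (p := m+1) Finset.univ (fun c => q c)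
    (by simp) (fun a _ => a.1) (fun a => contDiff_const) (δ/2) (by positivity)
  have hcont : Continuous fun y => ∑ a, ρ a y • (a.1 + s a) := by fun_prop
  have hdist : ∀ y, dist (∑ a, ρ a y • (a.1 + s a)) (φ y) ≤ δ := by
    intro y
    refine pou_dist (fun a => ρ a y) (fun a => hρ0 a y) (hρ1 y) _ _ _ ?_
    intro a ha
    have h1 : dist (φ y) a.1 < δ/2 := hVU a (hρV a y ha)
    have h2 := hs a
    calc dist (a.1 + s a) (φ y) ≤ dist (a.1 + s a) a.1 + dist a.1 (φ y) := dist_triangle _ _ _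
      _ ≤ δ/2 + δ/2 := by
        refine add_le_add ?_ ?_
        · rw [dist_eq_norm, add_sub_cancel_left]; exact h2.le
        · rw [dist_comm]; exact h1.le
      _ = δ := by ring
  obtain ⟨C, hC⟩ := φ.bounded
  let ψ : Y →ᵇ EuclideanSpace ℝ (Fin (m+1)) := BoundedContinuousFunction.mkOfBound
    ⟨_, hcont⟩ (δ + C + δ) (by
      intro y z
      refine (dist_triangle4 _ (φ y) (φ z) _).trans ?_
      refine add_le_add (add_le_add (hdist y) (hC y z)) ?_
      rw [dist_comm]; exact hdist z)
  let Kv : (Fin (m+1) → t) → Set (EuclideanSpace ℝ (Fin (m+1))) := fun v =>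
    (fun lam : Fin (m+1) → ℝ => ∑ j, lam j • ((v j).1 + s (v j))) '' stdSimplex ℝ (Fin (m+1))
  have hKc : ∀ v, IsCompact (Kv v) := fun v =>
    (isCompact_stdSimplex ℝ _).image (by fun_prop)
  have hK : IsCompact (⋃ v, Kv v) := isCompact_iUnion hKc
  have hq : q ∉ ⋃ v, Kv v := by
    intro hq
    obtain ⟨v, lam, hl, hlq⟩ := mem_iUnion.1 hq
    refine hsv (fun _ => v) (fun l l' hll' => absurd (Subsingleton.elim l l') hll') ?_
    exact ⟨0, ⟨le_rfl, fun i => zero_le_one⟩, fun _ => lam, fun _ j => hl.1 j, fun _ => hl.2, q,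
      fun _ _ => rfl, fun _ => hlq⟩
  have hmem : ∀ y, ψ y ∈ ⋃ v, Kv v := by
    intro y
    obtain ⟨v, lam, h0, h1, _, h3⟩ := bary_repr (k := m) (fun a => ρ a y) (fun a => hρ0 a y) (hρ1 y)
      ((ncard_le_ncard (fun a ha => hρV a y ha) (toFinite _)).trans (hVn y))
    refine mem_iUnion.2 ⟨v, lam, ⟨h0, h1⟩, ?_⟩
    exact (h3 (fun a => a.1 + s a)).symm
  refine ⟨ψ, hdist, ?_⟩
  obtain ⟨η, hη, hb⟩ := Metric.isOpen_iff.1 hK.isClosed.isOpen_compl q hq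
  refine ⟨η, hη, fun y => ?_⟩
  by_contra hlt
  exact hb (mem_ball.2 (not_le.1 hlt)) (hmem y)

theorem exists_Phi {Y : Type*} [TopologicalSpace Y] [NormalSpace Y] {m : ℕ} (h : CovDimLENat Y m)
    (φ0 : (Y × (ℕ × ℕ)) →ᵇ ℝ) : ∃ Φ : (Y × (ℕ × ℕ)) →ᵇ ℝ, (∀ x, dist (Φ x) (φ0 x) < 1/4) ∧
      ∀ (g : Fin (m+1) → ℕ × ℕ), Function.Injective g → ∀ y, ∃ l, Φ (y, g l) ≠ 1/2 := by
  let G : {g : Fin (m+1) → ℕ × ℕ // Function.Injective g} → Set ((Y × (ℕ × ℕ)) →ᵇ ℝ) := fun g =>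
    {Φ | ∃ η > 0, ∀ y, ∃ l, η ≤ dist (Φ (y, g.1 l)) (1/2)}
  have hopen : ∀ g, IsOpen (G g) := by
    intro g
    rw [Metric.isOpen_iff]
    rintro Φ ⟨η, hη, hΦ⟩
    refine ⟨η/2, by positivity, fun Ψ hΨ => ⟨η/2, by positivity, fun y => ?_⟩⟩
    obtain ⟨l, hl⟩ := hΦ y
    refine ⟨l, ?_⟩
    have h1 : dist (Ψ (y, g.1 l)) (Φ (y, g.1 l)) < η/2 :=
      (BoundedContinuousFunction.dist_coe_le_dist _).trans_lt hΨ
    have h2 := dist_triangle_left (Φ (y, g.1 l)) (1/2) (Ψ (y, g.1 l))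
    linarith
  have hdense : ∀ g, Dense (G g) := by
    rintro ⟨g, hg⟩
    rw [Metric.dense_iff]
    intro Φ ε hε
    let φ : Y →ᵇ EuclideanSpace ℝ (Fin (m+1)) := BoundedContinuousFunction.mkOfBound
      ⟨fun y => WithLp.toLp 2 (fun l => Φ (y, g l)), by fun_prop⟩
      (∑ l : Fin (m+1), 2 * ‖Φ‖) (by
        intro y z
        show dist (WithLp.toLp 2 (fun l => Φ (y, g l))) (WithLp.toLp 2 (fun l => Φ (z, g l))) ≤ _
        rw [EuclideanSpace.dist_eq]
        refine Real.sqrt_le_iff.2 ⟨by positivity, ?_⟩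
        refine le_trans ?_ (Finset.sum_sq_le_sq_sum_of_nonneg (fun i _ => by positivity))
        refine Finset.sum_le_sum fun l _ => ?_
        exact pow_le_pow_left₀ dist_nonneg (Φ.dist_le_two_norm _ _) 2)
    obtain ⟨ψ, hψ, η, hη, hψη⟩ := lemmaU h φ (WithLp.toLp 2 (fun _ => 1/2)) (ε/2) (by positivity)
    classical
    have hcd : ∀ y l, dist (ψ y l) (Φ (y, g l)) ≤ ε/2 := by
      intro y l
      refine le_trans ?_ (hψ y)
      rw [dist_eq_norm, dist_eq_norm]
      exact PiLp.norm_apply_le (ψ y - φ y) l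
    let F : Y × (ℕ × ℕ) → ℝ := fun x => if h : ∃ l, g l = x.2 then ψ x.1 h.choose else Φ x
    have hFd : ∀ x, dist (F x) (Φ x) ≤ ε/2 := by
      rintro ⟨y, s⟩
      by_cases hs : ∃ l, g l = s
      · simp only [F, dif_pos hs]
        have := hcd y hs.choose
        rwa [hs.choose_spec] at this
      · simp only [F, dif_neg hs, dist_self]; positivity
    have hFg : ∀ y l, F (y, g l) = ψ y l := by
      intro y l
      have hs : ∃ l', g l' = g l := ⟨l, rfl⟩
      simp only [F, dif_pos hs]
      rw [hg hs.choose_spec]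
    have hFc : Continuous F := by
      rw [continuous_prod_of_discrete_right]
      intro s
      by_cases hs : ∃ l, g l = s
      · simp only [F, dif_pos hs]
        exact (EuclideanSpace.proj (𝕜 := ℝ) hs.choose).continuous.comp ψ.continuous
      · simp only [F, dif_neg hs]; fun_prop
    let Ψ : (Y × (ℕ × ℕ)) →ᵇ ℝ := BoundedContinuousFunction.mkOfBound ⟨F, hFc⟩
      (ε/2 + 2 * ‖Φ‖ + ε/2) (by
      intro y z
      refine (dist_triangle4 _ (Φ y) (Φ z) _).trans ?_
      refine add_le_add (add_le_add (hFd y) (Φ.dist_le_two_norm y z)) ?_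
      rw [dist_comm]; exact hFd z)
    refine ⟨Ψ, ?_, ?_⟩
    · rw [mem_ball]
      refine ((BoundedContinuousFunction.dist_le (by positivity)).2 (fun x => hFd x)).trans_lt (by linarith)
    · have hcn : Continuous (fun x : Fin (m+1) → ℝ => (WithLp.toLp 2 x : EuclideanSpace ℝ (Fin (m+1)))) := by
        fun_prop
      obtain ⟨η', hη', hη2⟩ := Metric.continuous_iff.1 hcn (fun _ => 1/2) η hη
      refine ⟨η', hη', fun y => ?_⟩
      by_contra hcon
      push Not at hcon
      have := hη2 (fun l => ψ y l) (by
        rw [dist_pi_lt_iff hη']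
        intro l
        have := hcon l
        show dist (ψ y l) (1/2) < η'
        rw [← hFg]; exact this)
      exact absurd (hψη y) (not_le.2 this)
  obtain ⟨Φ, hΦ1, hΦ2⟩ := Metric.dense_iff.1 (dense_iInter_of_isOpen hopen hdense) φ0 (1/4) (by norm_num)
  refine ⟨Φ, fun x => (BoundedContinuousFunction.dist_coe_le_dist _).trans_lt hΦ1, fun g hg y => ?_⟩
  obtain ⟨η, hη, h3⟩ := mem_iInter.1 hΦ2 ⟨g, hg⟩
  obtain ⟨l, hl⟩ := h3 y
  exact ⟨l, dist_pos.1 (hη.trans_le hl)⟩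

theorem encard_le_of_inj {α : Type*} (s : Set α) (m : ℕ)
    (h : ∀ g : Fin (m+1) → α, Function.Injective g → ∃ l, g l ∉ s) : s.encard ≤ m := by
  by_contra hcon
  push Not at hcon
  have hle : ((m+1 : ℕ) : ℕ∞) ≤ s.encard := by
    have := Order.add_one_le_of_lt hcon
    exact_mod_cast this
  obtain ⟨t, hts, htc⟩ := exists_subset_encard_eq hle
  have hf : t.Finite := finite_of_encard_eq_coe htc
  rw [hf.encard_eq_coe_toFinset_card] at htc
  have hc : hf.toFinset.card = m + 1 := by exact_mod_cast htc
  obtain ⟨l, hl⟩ := h (fun i => (hf.toFinset.equivFinOfCardEq hc).symm i)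
    (Subtype.val_injective.comp (Equiv.injective _))
  apply hl
  apply hts
  have := ((hf.toFinset.equivFinOfCardEq hc).symm l).2
  exact hf.mem_toFinset.1 this

theorem exists_lstruct {Y : Type*} [MetricSpace Y] {m : ℕ} (h : CovDimLENat Y m) :
    ∃ S : LStruct Y (ℕ × ℕ) (ℕ × ℕ) Y, ∀ y, {l | y ∈ S.L l}.encard ≤ m := by
  have hwf : WellFounded (WellOrderingRel : Y → Y → Prop) := IsWellFounded.wf
  let R : ℕ → ℝ := fun ν => 1 / ((ν : ℝ) + 1)
  have hR : ∀ ν, 0 < R ν := fun ν => Nat.one_div_pos_of_nat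
  let Q : ℕ × ℕ → Y → Set Y := fun s y =>
    {z | dist z y + R s.2 ≤ R s.1 ∧ ∀ y', WellOrderingRel y' y → R s.1 ≤ dist z y'}
  let D : ℕ × ℕ → ℝ := fun s => R s.2 / 4
  have hD : ∀ s, 0 < D s := fun s => by have := hR s.2; simp only [D]; positivity
  have hsep : ∀ s y y', WellOrderingRel y y' → ∀ z ∈ Q s y, ∀ z' ∈ Q s y', R s.2 ≤ dist z z' := by
    rintro s y y' hyy z ⟨hz, _⟩ z' ⟨_, hz'⟩
    have h1 := hz' y hyy
    have h2 := dist_triangle_left z' y z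
    linarith
  have hdis : ∀ s y y', WellOrderingRel y y' → Disjoint (thickening (D s) (Q s y)) (thickening (D s) (Q s y')) := by
    intro s y y' hyy
    rw [disjoint_left]
    intro x hx hx'
    obtain ⟨z, hz, hxz⟩ := mem_thickening_iff.1 hx
    obtain ⟨z', hz', hxz'⟩ := mem_thickening_iff.1 hx'
    have h1 := hsep s y y' hyy z hz z' hz'
    have h2 := dist_triangle_left z z' x
    have := hR s.2
    simp only [D] at hxz hxz'
    linarith
  let F : Y × (ℕ × ℕ) → ℝ := fun x => ((thickenedIndicator (hD x.2) (⋃ y, Q x.2 y) x.1 : NNReal) : ℝ)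
  have hFc : Continuous F := by
    rw [continuous_prod_of_discrete_right]
    intro s
    exact NNReal.continuous_coe.comp (thickenedIndicator (hD s) (⋃ y, Q s y)).continuous
  have hF0 : ∀ x, 0 ≤ F x := fun x => NNReal.coe_nonneg _
  have hF1 : ∀ x, F x ≤ 1 := fun x => by
    have := thickenedIndicator_le_one (hD x.2) (⋃ y, Q x.2 y) x.1
    exact_mod_cast this
  obtain ⟨Φ, hΦ1, hΦ2⟩ := exists_Phi h (BoundedContinuousFunction.mkOfBound ⟨F, hFc⟩ 1 (by
    intro x y
    show dist (F x) (F y) ≤ 1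
    rw [Real.dist_eq, abs_le]
    constructor <;> linarith [hF0 x, hF0 y, hF1 x, hF1 y]))
  have hΦ : ∀ x, |Φ x - F x| < 1/4 := fun x => hΦ1 x
  have hbig : ∀ s x, 1/2 < Φ (x, s) → x ∈ ⋃ y, thickening (D s) (Q s y) := by
    intro s x hx
    rw [← thickening_iUnion]
    by_contra hcon
    have h0 : F (x, s) = 0 := by
      simp only [F]
      rw [thickenedIndicator_zero (hD s) _ hcon]; simp
    have := hΦ (x, s)
    rw [h0, abs_lt] at this
    linarith [this.2]
  refine ⟨⟨fun s => {y | Φ (y, s) = 1/2}, ?_, fun s y => {x | 1/2 < Φ (x, s)} ∩ thickening (D s) (Q s y),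
    ?_, ?_, fun s => {s}, ?_, ?_⟩, ?_⟩
  · exact fun s => isClosed_eq (by fun_prop) continuous_const
  · exact fun s y => (isOpen_lt continuous_const (by fun_prop)).inter isOpen_thickening
  · intro s i j hij
    refine Disjoint.mono inter_subset_right inter_subset_right ?_
    rcases trichotomous_of WellOrderingRel i j with h | h | h
    · exact hdis s i j h
    · exact absurd h hij
    · exact (hdis s j i h).symm
  · intro s
    have hU : (⋃ j, {x | 1/2 < Φ (x, s)} ∩ thickening (D s) (Q s j)) ⊆ {x | 1/2 ≤ Φ (x, s)} := by
      refine iUnion_subset fun j x hx => ?_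
      exact le_of_lt (show 1/2 < Φ (x, s) from hx.1)
    have hcl : IsClosed {x | 1/2 ≤ Φ (x, s)} := isClosed_le continuous_const (by fun_prop)
    intro x hx
    have hx' : 1/2 ≤ Φ (x, s) := closure_minimal hU hcl hx
    rcases hx'.lt_or_eq with h | h
    · left
      obtain ⟨j, hj⟩ := mem_iUnion.1 (hbig s x h)
      exact mem_iUnion.2 ⟨j, h, hj⟩
    · right
      exact mem_biUnion (x := s) rfl h.symm
  · intro x U hU
    obtain ⟨ε, hε, hεU⟩ := Metric.mem_nhds_iff.1 hU
    obtain ⟨ν, hν⟩ := exists_nat_one_div_lt (show 0 < ε / 2 by positivity)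
    have hne : {y | dist x y < R ν}.Nonempty := ⟨x, by show dist x x < R ν; rw [dist_self]; exact hR ν⟩
    set y := hwf.min _ hne with hy
    have hyd : dist x y < R ν := hwf.min_mem _ hne
    obtain ⟨e, he⟩ := exists_nat_one_div_lt (sub_pos.2 hyd)
    have hxQ : x ∈ Q (ν, e) y := by
      refine ⟨?_, ?_⟩
      · show dist x y + R e ≤ R ν
        have : R e < R ν - dist x y := he
        linarith
      · intro y' hy'
        by_contra hlt
        exact hwf.not_lt_min _ (show y' ∈ {y | dist x y < R ν} from not_le.1 hlt) hy'
    have hFx : F (x, (ν, e)) = 1 := by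
      simp only [F]
      rw [thickenedIndicator_one (hD _) _ (mem_iUnion.2 ⟨y, hxQ⟩)]; simp
    have hΦx : 1/2 < Φ (x, (ν, e)) := by
      have := hΦ (x, (ν, e))
      rw [hFx, abs_lt] at this
      linarith [this.1]
    refine ⟨(ν, e), y, ⟨hΦx, self_subset_thickening (hD _) _ hxQ⟩, ?_, ?_⟩
    · rintro z ⟨_, hz⟩
      apply hεU
      obtain ⟨z', ⟨hz', _⟩, hzz'⟩ := mem_thickening_iff.1 hz
      have := hR e
      have h3 : R ν < ε/2 := hν
      simp only [D] at hzz'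
      rw [mem_ball]
      have h1 := dist_triangle4 z z' y x
      have h2 := dist_comm x y
      dsimp only at hz'
      linarith
    · rintro l rfl hl
      exact absurd hl hΦx.ne'
  · intro y
    exact encard_le_of_inj _ _ fun g hg => hΦ2 g hg y

/-- Product of a structure with Euclidean space. -/
def LStruct.prodE {Y Λ ι J : Type*} [TopologicalSpace Y] (S : LStruct Y Λ ι J) (p : ℕ) :
    LStruct (Y × EuclideanSpace ℝ (Fin p)) (Λ ⊕ (Fin p × ℚ)) (ι × (Fin p → ℚ × ℚ)) J where
  L l := Sum.elim (fun l => Prod.fst ⁻¹' S.L l) (fun cq => {x | x.2 cq.1 = cq.2}) l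
  closedL l := by
    rcases l with l | ⟨c, a⟩
    · exact (S.closedL l).preimage continuous_fst
    · exact isClosed_eq (by fun_prop) continuous_const
  N s j := {x | x.1 ∈ S.N s.1 j ∧ ∀ c, ((s.2 c).1 : ℝ) < x.2 c ∧ x.2 c < (s.2 c).2}
  openN s j := by
    apply IsOpen.inter
    · exact (S.openN s.1 j).preimage continuous_fst
    · show IsOpen {x : Y × EuclideanSpace ℝ (Fin p) | ∀ c, ((s.2 c).1 : ℝ) < x.2 c ∧ x.2 c < (s.2 c).2}
      simp only [setOf_forall]
      refine isOpen_iInter_of_finite fun c => ?_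
      have hc : Continuous fun x : Y × EuclideanSpace ℝ (Fin p) => x.2 c := by fun_prop
      exact (isOpen_lt continuous_const hc).and (isOpen_lt hc continuous_const)
  disj s i j h := by
    rw [disjoint_left]
    intro x hx hx'
    exact disjoint_left.1 (S.disj s.1 i j h) hx.1 hx'.1
  FL s := {l | Sum.elim (fun l => l ∈ S.FL s.1) (fun cq => cq.2 = (s.2 cq.1).1 ∨ cq.2 = (s.2 cq.1).2) l}
  clos s := by
    have h1 : (⋃ j, {x : Y × EuclideanSpace ℝ (Fin p) | x.1 ∈ S.N s.1 j ∧ ∀ c, ((s.2 c).1 : ℝ) < x.2 c ∧ x.2 c < (s.2 c).2}) ⊆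
        (Prod.fst ⁻¹' closure (⋃ j, S.N s.1 j)) ∩
          {x : Y × EuclideanSpace ℝ (Fin p) | ∀ c, ((s.2 c).1 : ℝ) ≤ x.2 c ∧ x.2 c ≤ (s.2 c).2} := by
      refine iUnion_subset fun j x hx => ⟨subset_closure (mem_iUnion.2 ⟨j, hx.1⟩), fun c => ?_⟩
      exact ⟨(hx.2 c).1.le, (hx.2 c).2.le⟩
    have h2 : IsClosed ((Prod.fst ⁻¹' closure (⋃ j, S.N s.1 j)) ∩
          {x : Y × EuclideanSpace ℝ (Fin p) | ∀ c, ((s.2 c).1 : ℝ) ≤ x.2 c ∧ x.2 c ≤ (s.2 c).2}) := by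
      refine (isClosed_closure.preimage continuous_fst).inter ?_
      simp only [setOf_forall]
      refine isClosed_iInter fun c => ?_
      have hc : Continuous fun x : Y × EuclideanSpace ℝ (Fin p) => x.2 c := by fun_prop
      exact (isClosed_le continuous_const hc).and (isClosed_le hc continuous_const)
    intro x hx
    obtain ⟨ha, hb⟩ := closure_minimal h1 h2 hx
    rcases S.clos s.1 ha with hN | hL
    · by_cases hall : ∀ c, ((s.2 c).1 : ℝ) < x.2 c ∧ x.2 c < (s.2 c).2
      · left
        obtain ⟨j, hj⟩ := mem_iUnion.1 hN
        exact mem_iUnion.2 ⟨j, hj, hall⟩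
      · right
        push Not at hall
        obtain ⟨c, hc⟩ := hall
        rcases (hb c).1.lt_or_eq with h | h
        · refine mem_biUnion (x := Sum.inr (c, (s.2 c).2)) (Or.inr rfl) ?_
          exact le_antisymm (hb c).2 (hc h)
        · exact mem_biUnion (x := Sum.inr (c, (s.2 c).1)) (Or.inl rfl) h.symm
    · right
      obtain ⟨l, hl, hxl⟩ := mem_iUnion₂.1 hL
      exact mem_biUnion (x := Sum.inl l) hl hxl
  base x U hU := by
    obtain ⟨y, z⟩ := x
    rw [nhds_prod_eq, Filter.mem_prod_iff] at hU
    obtain ⟨A, hA, B, hB, hAB⟩ := hU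
    obtain ⟨s, j, h1, h2, h3⟩ := S.base y A hA
    have hcn : Continuous (fun x : Fin p → ℝ => (WithLp.toLp 2 x : EuclideanSpace ℝ (Fin p))) := by
      fun_prop
    have hB' : (fun x : Fin p → ℝ => (WithLp.toLp 2 x : EuclideanSpace ℝ (Fin p))) ⁻¹' B ∈ 𝓝 (fun c => z c) :=
      hcn.continuousAt hB
    obtain ⟨ε, hε, hεB⟩ := Metric.mem_nhds_iff.1 hB'
    have : ∀ c, ∃ ab : ℚ × ℚ, z c - ε < ab.1 ∧ (ab.1 : ℝ) < z c ∧ z c < ab.2 ∧ (ab.2 : ℝ) < z c + ε := by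
      intro c
      obtain ⟨a, ha1, ha2⟩ := exists_rat_btwn (show z c - ε < z c by linarith)
      obtain ⟨b, hb1, hb2⟩ := exists_rat_btwn (show z c < z c + ε by linarith)
      exact ⟨(a, b), ha1, ha2, hb1, hb2⟩
    choose ab hab using this
    refine ⟨(s, ab), j, ⟨h1, fun c => ⟨(hab c).2.1, (hab c).2.2.1⟩⟩, ?_, ?_⟩
    · rintro ⟨y', z'⟩ ⟨hy', hz'⟩
      apply hAB
      refine ⟨h2 hy', ?_⟩
      have : (fun c => z' c) ∈ ball (fun c => z c) ε := by
        rw [mem_ball, dist_pi_lt_iff hε]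
        intro c
        have h4 := hab c
        have h5 := hz' c
        dsimp only at h5
        rw [Real.dist_eq, abs_lt]
        constructor <;> linarith
      exact hεB this
    · rintro (l | ⟨c, a⟩) hl hx
      · exact h3 l hl hx
      · have hx' : z c = a := hx
        rcases hl with hl | hl
        · have := (hab c).2.1
          dsimp only at hl
          rw [hx', hl] at this
          exact lt_irrefl _ this
        · have := (hab c).2.2.1
          dsimp only at hl
          rw [hx', hl] at this
          exact lt_irrefl _ this

/-- openness property of a goodness predicate. -/
def PropO {X Y E : Type*} [TopologicalSpace X] [TopologicalSpace Y] [MetricSpace E]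
    (f : X → Y) (Good : Y → (X → E) → Prop) : Prop :=
  ∀ {K : Type} [TopologicalSpace K] [CompactSpace K] (h : X × K → E), Continuous h →
    ∀ y0, (∀ t, Good y0 (fun x => h (x, t))) → ∃ δ > 0, ∃ W ∈ 𝓝 y0, ∀ y ∈ W, ∀ t, ∀ φ : X → E,
      (∀ x, f x = y → dist (φ x) (h (x, t)) < δ) → Good y φ

/-- density property of a goodness predicate over single fibres, with `r` parameters. -/
def PropZ {X Y E : Type*} [TopologicalSpace X] [TopologicalSpace Y] [MetricSpace E]
    (f : X → Y) (Good : Y → (X → E) → Prop) (r : ℕ) : Prop :=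
  ∀ y (h : X × (Fin r → unitInterval) → E), Continuous h → ∀ δ > 0,
    ∃ h' : X × (Fin r → unitInterval) → E, Continuous h' ∧
      (∀ x t, f x = y → dist (h' (x, t)) (h (x, t)) < δ) ∧ ∀ t, Good y (fun x => h' (x, t))

/-- The actual goodness predicate. -/
def GoodP {X Y : Type*} [MetricSpace X] {p : ℕ} (f : X → Y) (n : ℕ) (ε : ℝ) (S : Finset (Fin p))
    (q : Fin p → ℝ) (y : Y) (φ : X → EuclideanSpace ℝ (Fin p)) : Prop :=
  ∀ x : Fin n → X, (∀ l, f (x l) = y) → (∀ l l', l ≠ l' → ε ≤ dist (x l) (x l')) →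
    ∀ z : EuclideanSpace ℝ (Fin p), (∀ c ∈ S, z c = q c) → ¬ ∀ l, φ (x l) = z

theorem goodP_O {X Y : Type*} [MetricSpace X] [MetricSpace Y] {p : ℕ} (f : X → Y)
    (hf : IsProperMap f) (n : ℕ) (ε : ℝ) (S : Finset (Fin p)) (q : Fin p → ℝ) :
    PropO f (GoodP f n ε S q) := by
  intro K _ _ h hh y0 hg
  let Δ : Set (Fin n → EuclideanSpace ℝ (Fin p)) :=
    {u | ∃ z : EuclideanSpace ℝ (Fin p), (∀ c ∈ S, z c = q c) ∧ ∀ l, u l = z}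
  have hΔne : Δ.Nonempty := ⟨fun _ => WithLp.toLp 2 q, WithLp.toLp 2 q, fun c _ => rfl, fun _ => rfl⟩
  have hΔc : IsClosed Δ := by
    have : Δ = {u | (∀ l l', u l = u l') ∧ ∀ l, ∀ c ∈ S, u l c = q c} := by
      ext u
      constructor
      · rintro ⟨z, hz, hu⟩
        exact ⟨fun l l' => by rw [hu, hu], fun l c hc => by rw [hu, hz c hc]⟩
      · rintro ⟨h1, h2⟩
        rcases Nat.eq_zero_or_pos n with hn | hn
        · subst hn
          exact ⟨WithLp.toLp 2 q, fun c _ => rfl, fun l => l.elim0⟩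
        · exact ⟨u ⟨0, hn⟩, h2 _, fun l => h1 _ _⟩
    rw [this]
    apply IsClosed.and
    · simp only [setOf_forall]
      exact isClosed_iInter fun l => isClosed_iInter fun l' => isClosed_eq (by fun_prop) (by fun_prop)
    · simp only [setOf_forall]
      exact isClosed_iInter fun l => isClosed_iInter fun c => isClosed_iInter fun _ =>
        isClosed_eq (by fun_prop) continuous_const
  let Sep : Set (Fin n → X) := {x | ∀ l l', l ≠ l' → ε ≤ dist (x l) (x l')}
  have hSep : IsClosed Sep := by
    simp only [Sep, setOf_forall]
    exact isClosed_iInter fun l => isClosed_iInter fun l' => isClosed_iInter fun _ =>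
      isClosed_le continuous_const (by fun_prop)
  let D : (Fin n → X) × K → ℝ := fun a => infDist (fun l => h (a.1 l, a.2)) Δ
  have hD : Continuous D := (continuous_infDist_pt Δ).comp (by fun_prop)
  have hcomp : ∀ y, IsCompact (f ⁻¹' {y}) := (isProperMap_iff_isClosedMap_and_compact_fibers.1 hf).2.2
  have hC0 : IsCompact ((pi univ fun _ : Fin n => f ⁻¹' {y0}) ∩ Sep) :=
    (isCompact_univ_pi fun _ => hcomp y0).inter_right hSep
  obtain ⟨δ, hδ, hδD⟩ := (hC0.prod (isCompact_univ (X := K))).exists_forall_le' hD.continuousOn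
    (a := 0) (by
      rintro ⟨x, t⟩ ⟨⟨hx1, hx2⟩, _⟩
      refine lt_of_le_of_ne infDist_nonneg fun h0 => ?_
      obtain ⟨z, hz, hz'⟩ := (hΔc.mem_iff_infDist_zero hΔne).2 h0.symm
      exact hg t x (fun l => hx1 l (mem_univ l)) hx2 z hz hz')
  let C : Set ((Fin n → X) × K) := {a | a.1 ∈ Sep ∧ D a ≤ δ/2}
  have hC : IsClosed C := (hSep.preimage continuous_fst).inter (isClosed_le hD continuous_const)
  have hF : IsProperMap (fun x : Fin n → X => fun l => f (x l)) := IsProperMap.pi_map fun _ => hf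
  have hI : IsClosed ((fun x : Fin n → X => fun l => f (x l)) '' (Prod.fst '' C)) :=
    hF.isClosedMap _ (isClosedMap_fst_of_compactSpace _ hC)
  refine ⟨δ/2, by positivity, {y | (fun _ : Fin n => y) ∉
    ((fun x : Fin n → X => fun l => f (x l)) '' (Prod.fst '' C))}, ?_, ?_⟩
  · have ho : IsOpen {y | (fun _ : Fin n => y) ∉
      ((fun x : Fin n → X => fun l => f (x l)) '' (Prod.fst '' C))} :=
      hI.isOpen_compl.preimage (by fun_prop : Continuous fun y : Y => fun _ : Fin n => y)
    refine ho.mem_nhds ?_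
    rintro ⟨x, ⟨⟨x', t⟩, ⟨hx1, hx2⟩, rfl⟩, hx3⟩
    have := hδD (x', t) ⟨⟨fun l _ => congrFun hx3 l, hx1⟩, mem_univ _⟩
    linarith
  · intro y hy t φ hφ x hx hsep z hz hxz
    apply hy
    refine ⟨x, ⟨(x, t), ⟨hsep, ?_⟩, rfl⟩, funext hx⟩
    have : (fun _ : Fin n => z) ∈ Δ := ⟨z, hz, fun _ => rfl⟩
    refine (infDist_le_dist_of_mem this).trans ?_
    rw [dist_pi_le_iff (by positivity)]
    intro l
    rw [← hxz l, dist_comm]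
    exact (hφ (x l) (hx l)).le

theorem PropO.isOpen {X Y E : Type*} [TopologicalSpace X] [TopologicalSpace Y] [MetricSpace E]
    {f : X → Y} {Good : Y → (X → E) → Prop} (hO : PropO f Good) {K : Type} [TopologicalSpace K]
    [CompactSpace K] (h : X × K → E) (hh : Continuous h) :
    IsOpen {y | ∀ t, Good y (fun x => h (x, t))} := by
  rw [isOpen_iff_mem_nhds]
  intro y hy
  obtain ⟨δ, hδ, W, hW, hWg⟩ := hO h hh y hy
  filter_upwards [hW] with y' hy' t
  exact hWg y' hy' t _ fun x _ => by rw [dist_self]; exact hδ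

theorem PropO.margin {X Y E : Type*} [TopologicalSpace X] [MetricSpace Y] [MetricSpace E]
    {f : X → Y} {Good : Y → (X → E) → Prop} (hO : PropO f Good) {K : Type} [TopologicalSpace K]
    [CompactSpace K] (h : X × K → E) (hh : Continuous h) (Q : Set Y) (hQ : IsClosed Q)
    (hg : ∀ y ∈ Q, ∀ t, Good y (fun x => h (x, t))) :
    ∃ β : Y → ℝ, Continuous β ∧ (∀ y, 0 < β y) ∧ ∀ y ∈ Q, ∀ t, ∀ φ : X → E,
      (∀ x, f x = y → dist (φ x) (h (x, t)) < β y) → Good y φ := by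
  obtain ⟨g, hg'⟩ := exists_continuous_forall_mem_convex_of_local_const (X := Y) (E := ℝ)
    (t := fun y => {b | 0 < b ∧ (y ∈ Q → ∀ t, ∀ φ : X → E,
      (∀ x, f x = y → dist (φ x) (h (x, t)) < b) → Good y φ)}) (by
      intro y
      apply Set.OrdConnected.convex
      refine ⟨?_⟩
      rintro a ⟨ha, _⟩ b ⟨_, hb⟩ c ⟨hac, hcb⟩
      exact ⟨ha.trans_le hac, fun hy t φ hφ => hb hy t φ fun x hx => (hφ x hx).trans_le hcb⟩) (by
      intro y
      by_cases hy : y ∈ Q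
      · obtain ⟨δ, hδ, W, hW, hWg⟩ := hO h hh y (hg y hy)
        refine ⟨δ, ?_⟩
        filter_upwards [hW] with y' hy'
        exact ⟨hδ, fun _ => hWg y' hy'⟩
      · refine ⟨1, ?_⟩
        filter_upwards [hQ.isOpen_compl.mem_nhds hy] with y' hy'
        exact ⟨one_pos, fun h => absurd h hy'⟩)
  exact ⟨g, g.continuous, fun y => (hg' y).1, fun y hy => (hg' y).2 hy⟩

theorem goodP_Z {X Y : Type*} [MetricSpace X] [MetricSpace Y] {p : ℕ} (f : X → Y)
    (hf : IsProperMap f) (n : ℕ) (ε : ℝ) (hε : 0 < ε) (S : Finset (Fin p)) (q : Fin p → ℝ) (k r : ℕ)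
    (hk : ∀ y, CovDimLENat (f ⁻¹' {y}) k) (hdim : r + n * k + (p - S.card) < n * p) :
    PropZ f (GoodP f n ε S q) r := by
  intro y h hh δ hδ
  have hcomp : IsCompact (f ⁻¹' {y}) := (isProperMap_iff_isClosedMap_and_compact_fibers.1 hf).2.2 y
  let H : C(X, C((Fin r → unitInterval), EuclideanSpace ℝ (Fin p))) := ContinuousMap.curry ⟨h, hh⟩
  have hH : ∀ x t, H x t = h (x, t) := fun x t => rfl
  let U : X → Set X := fun a => ball a (ε/2) ∩ {x | dist (H x) (H a) < δ/4}
  have hUo : ∀ a, IsOpen (U a) := fun a =>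
    isOpen_ball.inter (isOpen_lt (by fun_prop) continuous_const)
  have hUm : ∀ a, a ∈ U a := fun a => ⟨mem_ball_self (by positivity), by
    show dist (H a) (H a) < δ/4
    rw [dist_self]; positivity⟩
  obtain ⟨T, hTF, hT⟩ := hcomp.elim_nhds_subcover U (fun a _ => (hUo a).mem_nhds (hUm a))
  obtain ⟨V, hVo, hVU, hVc, hVn⟩ := (hk y).finite_refine (fun a : T => (Subtype.val ⁻¹' U a.1))
    (fun a => (hUo a.1).preimage continuous_subtype_val) (by
      rw [eq_univ_iff_forall]
      intro x
      obtain ⟨a, ha, hxa⟩ := mem_iUnion₂.1 (hT x.2)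
      exact mem_iUnion.2 ⟨⟨a, ha⟩, hxa⟩)
  obtain ⟨ρ, hρ0, hρ1, hρV⟩ := exists_pou V hVo hVc
  have hext : ∀ a : T, ∃ g : C(X, ℝ), ContinuousMap.restrict (f ⁻¹' {y}) g = ρ a := fun a =>
    ContinuousMap.exists_restrict_eq hcomp.isClosed (ρ a)
  choose ξ hξ using hext
  have hξ' : ∀ a (x : f ⁻¹' {y}), ξ a x.1 = ρ a x := fun a x => by rw [← hξ a]; rfl
  let pr : (Fin r → ℝ) → (Fin r → unitInterval) := fun t i => projIcc 0 1 zero_le_one (t i)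
  have hpr : Continuous pr := continuous_pi fun i => continuous_projIcc.comp (continuous_apply i)
  have hprv : ∀ t : Fin r → unitInterval, pr (fun i => (t i : ℝ)) = t := fun t => by
    funext i; exact projIcc_val zero_le_one (t i)
  have hw : ∀ a : T, ∃ w : (Fin r → ℝ) → EuclideanSpace ℝ (Fin p), ContDiff ℝ 1 w ∧
      ∀ t, dist (w t) (h (a.1, pr t)) < δ/4 := by
    intro a
    obtain ⟨w, hw1, hw2, _⟩ := Continuous.exists_contDiff_approx (f := fun t => h (a.1, pr t))
      (ε := fun _ => δ/4) 1 (by fun_prop) continuous_const (fun _ => by positivity)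
    exact ⟨w, hw1, hw2⟩
  choose w hw1 hw2 using hw
  obtain ⟨s, hs, hsv⟩ := genpos (n := n) (k := k) S q hdim w hw1 (δ/4) (by positivity)
  refine ⟨fun a => ∑ b, ξ b a.1 • (w b (fun i => (a.2 i : ℝ)) + s b), ?_, ?_, ?_⟩
  · refine continuous_finset_sum _ fun b _ => ?_
    have := (hw1 b).continuous
    fun_prop
  · intro x t hx
    let x' : f ⁻¹' {y} := ⟨x, hx⟩
    refine lt_of_le_of_lt (pou_dist (fun b => ξ b x) (fun b => ?_) ?_ _ _ (3 * δ / 4) ?_) (by linarith)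
    · show 0 ≤ ξ b x'.1
      rw [hξ']; exact hρ0 b x'
    · have := hρ1 x'
      simp only [← hξ'] at this
      exact this
    · intro b hb
      have hb' : ρ b x' ≠ 0 := by rw [← hξ']; exact hb
      have hxU : x ∈ U b.1 := hVU b (hρV b x' hb')
      have h1 : dist (h (x, t)) (h (b.1, t)) < δ/4 := by
        rw [← hH, ← hH]
        exact (ContinuousMap.dist_apply_le_dist t).trans_lt hxU.2
      have h2 := hw2 b (fun i => (t i : ℝ))
      rw [hprv] at h2
      have h3 : dist (w b (fun i => (t i : ℝ)) + s b) (w b (fun i => (t i : ℝ))) < δ/4 := by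
        rw [dist_eq_norm, add_sub_cancel_left]; exact hs b
      have h4 := dist_triangle4 (w b (fun i => (t i : ℝ)) + s b) (w b (fun i => (t i : ℝ))) (h (b.1, t)) (h (x, t))
      rw [dist_comm (h (b.1, t))] at h4
      linarith
  · intro t x hx hsep z hz hxz
    have hrep := fun l => bary_repr (k := k) (fun b => ρ b ⟨x l, hx l⟩) (fun b => hρ0 b _) (hρ1 _)
      ((ncard_le_ncard (fun a ha => hρV a _ ha) (toFinite _)).trans (hVn _))
    choose v lam hl0 hl1 hlv hlsum using hrep
    refine hsv v ?_ ⟨fun i => (t i : ℝ), ⟨fun i => (t i).2.1, fun i => (t i).2.2⟩, lam, hl0, hl1, z, hz, ?_⟩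
    · intro l l' hll j j' heq
      have h1 : x l ∈ U (v l j).1 := hVU _ (hρV _ _ (hlv l j))
      have h2 : x l' ∈ U (v l' j').1 := hVU _ (hρV _ _ (hlv l' j'))
      rw [← heq] at h2
      have h3 : dist (x l) (v l j).1 < ε/2 := h1.1
      have h4 : dist (x l') (v l j).1 < ε/2 := h2.1
      have h5 := dist_triangle_right (x l) (x l') (v l j).1
      linarith [hsep l l' hll]
    · intro l
      rw [← hxz l, ← hlsum l (fun b => w b (fun i => (t i : ℝ)) + s b)]
      refine Finset.sum_congr rfl fun b _ => ?_
      rw [← hξ']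

theorem PropO.congr {X Y E : Type*} [TopologicalSpace X] [TopologicalSpace Y] [MetricSpace E]
    {f : X → Y} {Good : Y → (X → E) → Prop} (hO : PropO f Good) {y : Y} {φ ψ : X → E}
    (hψ : Continuous ψ) (hg : Good y ψ) (he : ∀ x, f x = y → φ x = ψ x) : Good y φ := by
  obtain ⟨δ, hδ, W, hW, hWg⟩ := hO (K := Unit) (fun a => ψ a.1) (by fun_prop) y (fun _ => hg)
  refine hWg y (mem_of_mem_nhds hW) () φ fun x hx => ?_
  rw [he x hx, dist_self]; exact hδ

/-- prepend a coordinate -/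
def consI {r : ℕ} (a : unitInterval) (t : Fin r → unitInterval) : Fin (r+1) → unitInterval :=
  Fin.cons a t

theorem continuous_consI {r : ℕ} {A : Type*} [TopologicalSpace A] {a : A → unitInterval}
    {t : A → Fin r → unitInterval} (ha : Continuous a) (ht : Continuous t) :
    Continuous fun x => consI (a x) (t x) := by
  refine continuous_pi fun i => ?_
  refine Fin.cases ?_ (fun i => ?_) i
  · simpa [consI] using ha
  · simp only [consI, Fin.cons_succ]; fun_prop

/-- clamp to the unit interval -/
noncomputable def clampI (a : ℝ) : unitInterval := projIcc 0 1 zero_le_one a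

theorem continuous_clampI : Continuous clampI := continuous_projIcc (h := zero_le_one)

theorem clampI_of_le {a : ℝ} (h : a ≤ 0) : clampI a = 0 := by
  exact projIcc_of_le_left zero_le_one h

theorem clampI_of_ge {a : ℝ} (h : 1 ≤ a) : clampI a = 1 := by
  exact projIcc_of_right_le zero_le_one h

section
variable {X Y E : Type*} [TopologicalSpace X] [NormedAddCommGroup E] [NormedSpace ℝ E]

/-- the reparametrised path from `s` to `e` through `P`. -/
noncomputable def pathP {r : ℕ} (s e : X × (Fin r → unitInterval) → E)
    (P : X × (Fin (r+1) → unitInterval) → E) (x : X) (t : Fin r → unitInterval) (τ : ℝ) : E :=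
  P (x, consI (clampI (τ - 1)) t) + (1 - (clampI τ : ℝ)) • (s (x, t) - P (x, consI 0 t))
    + (clampI (τ - 2) : ℝ) • (e (x, t) - P (x, consI 1 t))

theorem continuous_pathP {r : ℕ} {s e : X × (Fin r → unitInterval) → E}
    {P : X × (Fin (r+1) → unitInterval) → E} (hs : Continuous s) (he : Continuous e)
    (hP : Continuous P) {A : Type*} [TopologicalSpace A] {x : A → X} {t : A → Fin r → unitInterval}
    {τ : A → ℝ} (hx : Continuous x) (ht : Continuous t) (hτ : Continuous τ) :
    Continuous fun a => pathP s e P (x a) (t a) (τ a) := by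
  unfold pathP
  have h1 : Continuous fun a => clampI (τ a) := continuous_clampI.comp hτ
  have h2 : Continuous fun a => clampI (τ a - 1) := continuous_clampI.comp (by fun_prop)
  have h3 : Continuous fun a => clampI (τ a - 2) := continuous_clampI.comp (by fun_prop)
  have h4 : Continuous fun a => consI (clampI (τ a - 1)) (t a) := continuous_consI h2 ht
  have h5 : Continuous fun a => consI 0 (t a) := continuous_consI continuous_const ht
  have h6 : Continuous fun a => consI 1 (t a) := continuous_consI continuous_const ht
  fun_prop

theorem pathP_zero {r : ℕ} (s e : X × (Fin r → unitInterval) → E)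
    (P : X × (Fin (r+1) → unitInterval) → E) (x : X) (t : Fin r → unitInterval) :
    pathP s e P x t 0 = s (x, t) := by
  simp only [pathP]
  rw [clampI_of_le (by norm_num), clampI_of_le (by norm_num), clampI_of_le (by norm_num)]
  simp

theorem pathP_three {r : ℕ} (s e : X × (Fin r → unitInterval) → E)
    (P : X × (Fin (r+1) → unitInterval) → E) (x : X) (t : Fin r → unitInterval) :
    pathP s e P x t 3 = e (x, t) := by
  simp only [pathP]
  rw [clampI_of_ge (by norm_num), clampI_of_ge (by norm_num), clampI_of_ge (by norm_num)]
  simp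

theorem pathP_cases {r : ℕ} (s e : X × (Fin r → unitInterval) → E)
    (P : X × (Fin (r+1) → unitInterval) → E) (t : Fin r → unitInterval) (τ : ℝ) :
    (∀ x, dist (pathP s e P x t τ) (s (x, t)) ≤ dist (P (x, consI 0 t)) (s (x, t))) ∨
    (∃ a, ∀ x, pathP s e P x t τ = P (x, consI a t)) ∨
    (∀ x, dist (pathP s e P x t τ) (e (x, t)) ≤ dist (P (x, consI 1 t)) (e (x, t))) := by
  rcases le_total τ 1 with h1 | h1
  · left
    intro x
    simp only [pathP]
    rw [clampI_of_le (show τ - 1 ≤ 0 by linarith), clampI_of_le (show τ - 2 ≤ 0 by linarith)]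
    have : P (x, consI 0 t) + (1 - (clampI τ : ℝ)) • (s (x, t) - P (x, consI 0 t))
        + ((0 : unitInterval) : ℝ) • (e (x, t) - P (x, consI 1 t)) - s (x, t)
        = (clampI τ : ℝ) • (P (x, consI 0 t) - s (x, t)) := by
      simp only [Set.Icc.coe_zero]; module
    rw [dist_eq_norm, this, norm_smul, dist_eq_norm, Real.norm_of_nonneg (clampI τ).2.1]
    exact mul_le_of_le_one_left (norm_nonneg _) (clampI τ).2.2
  · right
    rcases le_total τ 2 with h2 | h2
    · left
      refine ⟨clampI (τ - 1), fun x => ?_⟩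
      simp only [pathP]
      rw [clampI_of_ge h1, clampI_of_le (show τ - 2 ≤ 0 by linarith)]
      simp
    · right
      intro x
      simp only [pathP]
      rw [clampI_of_ge h1, clampI_of_ge (show 1 ≤ τ - 1 by linarith)]
      have : P (x, consI 1 t) + (1 - ((1 : unitInterval) : ℝ)) • (s (x, t) - P (x, consI 0 t))
          + (clampI (τ - 2) : ℝ) • (e (x, t) - P (x, consI 1 t)) - e (x, t)
          = (1 - (clampI (τ - 2) : ℝ)) • (P (x, consI 1 t) - e (x, t)) := by
        simp only [Set.Icc.coe_one]; module
      have h3 : 0 ≤ 1 - (clampI (τ - 2) : ℝ) := sub_nonneg.2 (clampI (τ - 2)).2.2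
      rw [dist_eq_norm, this, norm_smul, dist_eq_norm, Real.norm_of_nonneg h3]
      refine mul_le_of_le_one_left (norm_nonneg _) ?_
      have := (clampI (τ - 2)).2.1
      linarith
end

theorem theoremS {X : Type*} {Y : Type*} {E : Type*} [TopologicalSpace X] [MetricSpace Y]
    [NormedAddCommGroup E] [NormedSpace ℝ E] (f : X → Y) (hfc : Continuous f) (hfcl : IsClosedMap f)
    (Good : Y → (X → E) → Prop) (hO : PropO f Good) (J : ℕ) (hZ : ∀ r ≤ J, PropZ f Good r)
    (Z : ℕ → Set Y) (hP : ∀ i, PZero (Z i)) :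
    ∀ j r : ℕ, j + r ≤ J + 1 → ∀ B : Set Y, IsClosed B → (∀ y ∈ B, ∃ i < j, y ∈ Z i) →
      ∀ g : X × (Fin r → unitInterval) → E, Continuous g → ∀ α : Y → ℝ, Continuous α → (∀ y, 0 < α y) →
      ∃ h : X × (Fin r → unitInterval) → E, Continuous h ∧
        (∀ x t, dist (h (x, t)) (g (x, t)) < α (f x)) ∧ ∀ y ∈ B, ∀ t, Good y (fun x => h (x, t)) := by
  intro j
  induction j with
  | zero =>
    intro r _ B _ hBZ g hg α hα hα0
    refine ⟨g, hg, fun x t => by rw [dist_self]; exact hα0 _, fun y hy => ?_⟩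
    obtain ⟨i, hi, _⟩ := hBZ y hy
    exact absurd hi (Nat.not_lt_zero i)
  | succ j ih =>
    intro r hr B hB hBZ g hg α hα hα0
    -- step 1
    have h1 : ∀ y, ∃ s : X × (Fin r → unitInterval) → E, Continuous s ∧ ∃ U : Set Y, IsOpen U ∧ y ∈ U ∧
        (∀ y' ∈ U, ∀ t, Good y' (fun x => s (x, t))) ∧
        (∀ x t, f x ∈ U → dist (s (x, t)) (g (x, t)) < α (f x) / 2) := by
      intro y
      obtain ⟨s, hs, hsd, hsg⟩ := hZ r (by omega) y g hg (α y / 2) (by have := hα0 y; positivity)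
      let D : Set (X × (Fin r → unitInterval)) := {a | α (f a.1) / 2 ≤ dist (s a) (g a)}
      have hD : IsClosed D := isClosed_le (by fun_prop) (by fun_prop)
      have hD' : IsClosed (f '' (Prod.fst '' D)) := hfcl _ (isClosedMap_fst_of_compactSpace _ hD)
      refine ⟨s, hs, {y' | ∀ t, Good y' (fun x => s (x, t))} ∩ (f '' (Prod.fst '' D))ᶜ,
        (hO.isOpen s hs).inter hD'.isOpen_compl, ⟨hsg, ?_⟩, fun y' hy' => hy'.1, ?_⟩
      · rintro ⟨x, ⟨⟨x', t⟩, hxt, rfl⟩, hx⟩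
        have := hsd x' t hx
        have h2 : α (f x') / 2 ≤ dist (s (x', t)) (g (x', t)) := hxt
        dsimp only at hx
        rw [hx] at h2
        linarith
      · intro x t hx
        by_contra hlt
        exact hx.2 ⟨x, ⟨(x, t), not_lt.1 hlt, rfl⟩, rfl⟩
    choose s hs U hUo hUm hUg hUd using h1
    obtain ⟨O, hOo, hOc, hOl, hOU⟩ := precise_refinement U hUo
      (eq_univ_iff_forall.2 fun y => mem_iUnion.2 ⟨y, hUm y⟩)
    obtain ⟨O', hO'c, hO'o, hO'O⟩ := exists_iUnion_eq_closure_subset hOo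
      (fun x => hOl.point_finite x) hOc
    have hCl : LocallyFinite fun w => closure (O' w) := hOl.subset hO'O
    have hCU : ∀ w, closure (O' w) ⊆ U w := fun w => (hO'O w).trans (hOU w)
    -- step 2
    obtain ⟨V, hVo, hVd, hVO, hVc⟩ := hP j Y O' hO'o (by rw [hO'c]; exact subset_univ _)
    have hVC : ∀ w, V w ⊆ closure (O' w) := fun w => (hVO w).trans subset_closure
    set R : Set Y := (⋃ w, V w)ᶜ with hRdef
    have hR : IsClosed R := (isOpen_iUnion hVo).isClosed_compl
    have hB' : IsClosed (B ∩ R) := hB.inter hR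
    have hB'Z : ∀ y ∈ B ∩ R, ∃ i < j, y ∈ Z i := by
      rintro y ⟨hyB, hyR⟩
      obtain ⟨i, hi, hyi⟩ := hBZ y hyB
      rcases Nat.lt_succ_iff_lt_or_eq.1 hi with h | h
      · exact ⟨i, h, hyi⟩
      · subst h; exact absurd (hVc hyi) hyR
    -- step 3
    obtain ⟨e, he, hed, heg⟩ := ih r (by omega) (B ∩ R) hB' hB'Z g hg (fun y => α y / 2) (by fun_prop)
      (fun y => by have := hα0 y; positivity)
    -- step 4
    have h4 : ∀ w, ∃ P : X × (Fin (r+1) → unitInterval) → E, Continuous P ∧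
        (∀ y ∈ B ∩ R ∩ closure (O' w), ∀ t τ, Good y (fun x => pathP (s w) e P x t τ)) ∧
        (∀ x t τ, f x ∈ closure (O' w) → dist (pathP (s w) e P x t τ) (g (x, t)) < α (f x)) := by
      intro w
      obtain ⟨β1, hβ1c, hβ1p, hβ1⟩ := hO.margin (s w) (hs w) (closure (O' w)) isClosed_closure
        (fun y hy t => hUg w y (hCU w hy) t)
      obtain ⟨β2, hβ2c, hβ2p, hβ2⟩ := hO.margin e he (B ∩ R) hB' heg
      let Lw : X × (Fin (r+1) → unitInterval) → E := fun a =>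
        (1 - (a.2 0 : ℝ)) • s w (a.1, fun i => a.2 i.succ) + (a.2 0 : ℝ) • e (a.1, fun i => a.2 i.succ)
      have hLw : Continuous Lw := by
        have := hs w
        fun_prop
      have hL0 : ∀ x t, Lw (x, consI 0 t) = s w (x, t) := by
        intro x t; simp [Lw, consI]
      have hL1 : ∀ x t, Lw (x, consI 1 t) = e (x, t) := by
        intro x t; simp [Lw, consI]
      obtain ⟨P, hPc, hPd, hPg⟩ := ih (r+1) (by omega) (B ∩ R ∩ closure (O' w))
        (hB'.inter isClosed_closure) (fun y hy => hB'Z y hy.1) Lw hLw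
        (fun y => min (min (β1 y) (β2 y)) (α y / 2)) (by fun_prop)
        (fun y => lt_min (lt_min (hβ1p y) (hβ2p y)) (by have := hα0 y; positivity))
      have d0 : ∀ x t, dist (P (x, consI 0 t)) (s w (x, t)) < min (min (β1 (f x)) (β2 (f x))) (α (f x) / 2) := by
        intro x t
        have := hPd x (consI 0 t)
        rwa [hL0] at this
      have d1 : ∀ x t, dist (P (x, consI 1 t)) (e (x, t)) < min (min (β1 (f x)) (β2 (f x))) (α (f x) / 2) := by
        intro x t
        have := hPd x (consI 1 t)
        rwa [hL1] at this
      refine ⟨P, hPc, ?_, ?_⟩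
      · intro y hy t τ
        rcases pathP_cases (s w) e P t τ with h | ⟨a, h⟩ | h
        · refine hβ1 y hy.2 t _ fun x hx => ?_
          refine (h x).trans_lt ((d0 x t).trans_le ?_)
          rw [hx]; exact (min_le_left _ _).trans (min_le_left _ _)
        · have := hPg y hy (consI a t)
          simp only [h]; exact this
        · refine hβ2 y hy.1 t _ fun x hx => ?_
          refine (h x).trans_lt ((d1 x t).trans_le ?_)
          rw [hx]; exact (min_le_left _ _).trans (min_le_right _ _)
      · intro x t τ hx
        have hsd := hUd w x t (hCU w hx)
        have hed' := hed x t
        rcases pathP_cases (s w) e P t τ with h | ⟨a, h⟩ | h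
        · have h2 := (h x).trans_lt ((d0 x t).trans_le (min_le_right _ _))
          have h3 := dist_triangle (pathP (s w) e P x t τ) (s w (x, t)) (g (x, t))
          linarith
        · rw [h]
          have h2 := (hPd x (consI a t)).trans_le (min_le_right _ _)
          have h3 := dist_triangle (P (x, consI a t)) (Lw (x, consI a t)) (g (x, t))
          have h4 : Lw (x, consI a t) ∈ ball (g (x, t)) (α (f x) / 2) := by
            have hm : Lw (x, consI a t) = (1 - (a : ℝ)) • s w (x, t) + (a : ℝ) • e (x, t) := by
              simp [Lw, consI]
            rw [hm]
            exact convex_ball _ _ (mem_ball.2 hsd) (mem_ball.2 hed') (sub_nonneg.2 a.2.2) a.2.1 (by ring)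
          rw [mem_ball] at h4
          linarith
        · have h2 := (h x).trans_lt ((d1 x t).trans_le (min_le_right _ _))
          have h3 := dist_triangle (pathP (s w) e P x t τ) (e (x, t)) (g (x, t))
          linarith
    choose P hPc hPg hPd using h4
    -- step 5
    let N : Y → Set Y := fun w => {y | ∀ a : (Fin r → unitInterval) × Icc (0:ℝ) 3,
      Good y (fun x => pathP (s w) e (P w) x a.1 a.2)}
    have hN : ∀ w, IsOpen (N w) := fun w =>
      hO.isOpen (K := (Fin r → unitInterval) × Icc (0:ℝ) 3)
        (fun a => pathP (s w) e (P w) a.1 a.2.1 a.2.2)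
        (continuous_pathP (hs w) he (hPc w) (by fun_prop) (by fun_prop) (by fun_prop))
    -- step 6
    set M : Set Y := ⋃ w, B ∩ closure (O' w) ∩ (N w)ᶜ with hMdef
    have hM : IsClosed M := by
      refine LocallyFinite.isClosed_iUnion ?_ fun w =>
        (hB.inter isClosed_closure).inter (hN w).isClosed_compl
      exact hCl.subset fun w y hy => hy.1.2
    have hMR : Disjoint M R := by
      rw [disjoint_left]
      intro y hy hyR
      obtain ⟨w, ⟨hyB, hyC⟩, hyN⟩ := mem_iUnion.1 hy
      exact hyN fun a => hPg w y ⟨⟨hyB, hyR⟩, hyC⟩ a.1 a.2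
    obtain ⟨θ0, hθM, hθR, hθI⟩ := exists_continuous_zero_one_of_isClosed hM hR hMR
    let θ : Y → ℝ := fun y => 3 * min 1 (2 * θ0 y)
    have hθ : Continuous θ := by fun_prop
    have hθ03 : ∀ y, θ y ∈ Icc (0:ℝ) 3 := fun y => by
      have h0 := (hθI y).1
      constructor
      · exact mul_nonneg (by norm_num) (le_min zero_le_one (by linarith))
      · have : min 1 (2 * θ0 y) ≤ 1 := min_le_left _ _
        simp only [θ]; linarith
    have hθ3 : ∀ y, 1/2 < θ0 y → θ y = 3 := fun y hy => by
      simp only [θ]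
      rw [min_eq_left (by linarith)]; norm_num
    have hθ0 : ∀ y ∈ M, θ y = 0 := fun y hy => by
      have : θ0 y = 0 := hθM hy
      simp [θ, this]
    -- step 7
    classical
    let h : X × (Fin r → unitInterval) → E := fun a =>
      if hw : ∃ w, f a.1 ∈ V w then pathP (s hw.choose) e (P hw.choose) a.1 a.2 (θ (f a.1)) else e a
    have hV : ∀ w x t, f x ∈ V w → h (x, t) = pathP (s w) e (P w) x t (θ (f x)) := by
      intro w x t hx
      have hw : ∃ w, f (x, t).1 ∈ V w := ⟨w, hx⟩
      have : hw.choose = w := by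
        by_contra hne
        exact disjoint_left.1 (hVd _ _ hne) hw.choose_spec hx
      simp only [h, dif_pos hw, this]
    have hnV : ∀ x t, f x ∈ R → h (x, t) = e (x, t) := by
      intro x t hx
      have hw : ¬ ∃ w, f (x, t).1 ∈ V w := by
        rintro ⟨w, hw⟩
        exact hx (mem_iUnion.2 ⟨w, hw⟩)
      simp only [h, dif_neg hw]
    have hdich : ∀ y, (∃ w, y ∈ V w) ∨ y ∈ R := by
      intro y
      by_cases hy : ∃ w, y ∈ V w
      · exact Or.inl hy
      · right; intro h'; exact hy (mem_iUnion.1 h')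
    refine ⟨h, ?_, ?_, ?_⟩
    · rw [continuous_iff_continuousAt]
      rintro ⟨x, t⟩
      rcases hdich (f x) with ⟨w, hw⟩ | hxR
      · have hc : Continuous fun a : X × (Fin r → unitInterval) => pathP (s w) e (P w) a.1 a.2 (θ (f a.1)) :=
          continuous_pathP (hs w) he (hPc w) (by fun_prop) (by fun_prop) (by fun_prop)
        refine hc.continuousAt.congr ?_
        have hop : IsOpen ((fun a : X × (Fin r → unitInterval) => f a.1) ⁻¹' V w) :=
          (hVo w).preimage (by fun_prop)
        filter_upwards [hop.mem_nhds (show (x, t) ∈ _ from hw)] with a ha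
        exact (hV w a.1 a.2 ha).symm
      · refine he.continuousAt.congr ?_
        have hop : IsOpen {a : X × (Fin r → unitInterval) | 1/2 < θ0 (f a.1)} :=
          isOpen_lt continuous_const (by fun_prop)
        have hx1 : θ0 (f x) = 1 := hθR hxR
        filter_upwards [hop.mem_nhds (show (x, t) ∈ _ from (by show 1/2 < θ0 (f x); rw [hx1]; norm_num))] with a ha
        rcases hdich (f a.1) with ⟨w, hw⟩ | haR
        · rw [show h a = _ from hV w a.1 a.2 hw, hθ3 _ ha, pathP_three]
        · exact (hnV a.1 a.2 haR).symm
    · intro x t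
      rcases hdich (f x) with ⟨w, hw⟩ | hxR
      · rw [hV w x t hw]
        exact hPd w x t _ (hVC w hw)
      · rw [hnV x t hxR]
        have := hα0 (f x)
        exact (hed x t).trans (by linarith)
    · intro y hy t
      rcases hdich y with ⟨w, hw⟩ | hyR
      · by_cases hyM : y ∈ M
        · refine hO.congr (ψ := fun x => s w (x, t)) (by have := hs w; fun_prop)
            (hUg w y (hCU w (hVC w hw)) t) ?_
          rintro x rfl
          rw [hV w x t hw, hθ0 _ hyM, pathP_zero]
        · have hyN : y ∈ N w := by
            by_contra hyN
            exact hyM (mem_iUnion.2 ⟨w, ⟨hy, hVC w hw⟩, hyN⟩)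
          refine hO.congr (ψ := fun x => pathP (s w) e (P w) x t (θ y))
            (continuous_pathP (hs w) he (hPc w) (by fun_prop) (by fun_prop) (by fun_prop))
            (hyN (t, ⟨θ y, hθ03 y⟩)) ?_
          rintro x rfl
          exact hV w x t hw
      · refine hO.congr (ψ := fun x => e (x, t)) (by fun_prop) (heg y ⟨hy, hyR⟩ t) ?_
        rintro x rfl
        exact hnV x t hyR

theorem CovDimLENat.mono {X : Type*} [TopologicalSpace X] {n m : ℕ} (h : CovDimLENat X n)
    (hnm : n ≤ m) : CovDimLENat X m := by
  intro U hf ho hc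
  obtain ⟨V, h1, h2, h3, h4⟩ := h U hf ho hc
  exact ⟨V, h1, h2, h3, fun x => ⟨(h4 x).1, (h4 x).2.trans (by omega)⟩⟩

theorem CovDimLENat.closedEmb {X T : Type*} [TopologicalSpace X] [TopologicalSpace T] {n : ℕ}
    (h : CovDimLENat X n) (e : T → X) (he : IsClosedEmbedding e) : CovDimLENat T n := by
  intro U hf ho hc
  have hex : ∀ W : Set T, ∃ W' : Set X, W ∈ U → IsOpen W' ∧ e ⁻¹' W' = W := by
    intro W
    by_cases hW : W ∈ U
    · obtain ⟨W', h1, h2⟩ := he.isInducing.isOpen_iff.1 (ho W hW)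
      exact ⟨W', fun _ => ⟨h1, h2⟩⟩
    · exact ⟨∅, fun h => absurd h hW⟩
  choose F hF using hex
  obtain ⟨V, h1, h2, h3, h4⟩ := h (insert (range e)ᶜ (F '' U)) ((hf.image F).insert _) (by
      rintro W (rfl | ⟨W, hW, rfl⟩)
      · exact he.isClosed_range.isOpen_compl
      · exact (hF W hW).1) (by
      refine eq_univ_of_forall fun x => ?_
      by_cases hx : x ∈ range e
      · obtain ⟨t, rfl⟩ := hx
        have : t ∈ ⋃₀ U := by rw [hc]; trivial
        obtain ⟨W, hW, ht⟩ := this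
        refine ⟨F W, mem_insert_of_mem _ ⟨W, hW, rfl⟩, ?_⟩
        rw [← (hF W hW).2] at ht
        exact ht
      · exact ⟨_, mem_insert _ _, hx⟩)
  refine ⟨{W | W.Nonempty ∧ ∃ V' ∈ V, e ⁻¹' V' = W}, ?_, ?_, ?_, ?_⟩
  · rintro W ⟨_, V', hV', rfl⟩
    exact (h1 V' hV').preimage he.continuous
  · refine eq_univ_of_forall fun t => ?_
    have : e t ∈ ⋃₀ V := by rw [h2]; trivial
    obtain ⟨W, hW, ht⟩ := this
    exact ⟨e ⁻¹' W, ⟨⟨t, ht⟩, W, hW, rfl⟩, ht⟩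
  · rintro W ⟨⟨t, ht⟩, V', hV', rfl⟩
    obtain ⟨U', hU', hs⟩ := h3 V' hV'
    rcases hU' with rfl | ⟨W, hW, rfl⟩
    · exact absurd (mem_range_self t) (hs ht)
    · refine ⟨W, hW, ?_⟩
      rw [← (hF W hW).2]
      exact preimage_mono hs
  · intro t
    have hs : {W ∈ {W : Set T | W.Nonempty ∧ ∃ V' ∈ V, e ⁻¹' V' = W} | t ∈ W} ⊆
        (fun W => e ⁻¹' W) '' {W ∈ V | e t ∈ W} := by
      rintro W ⟨⟨_, V', hV', rfl⟩, ht⟩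
      exact ⟨V', ⟨hV', ht⟩, rfl⟩
    have hfin := (h4 (e t)).1
    refine ⟨(hfin.image _).subset hs, ?_⟩
    exact (ncard_le_ncard hs (hfin.image _)).trans ((ncard_image_le hfin).trans (h4 (e t)).2)

theorem perfect_piece {X Y : Type*} [TopologicalSpace X] [TopologicalSpace Y] {f : X → Y}
    {A : Set X} (hA : IsClosed A) (hfA : IsClosed (f '' A))
    (hp : IsPerfectMap (Set.MapsTo.restrict f A (f '' A) (Set.mapsTo_image f A))) :
    (∀ D : Set X, IsClosed D → IsClosed (f '' (A ∩ D))) ∧ ∀ y, IsCompact (A ∩ f ⁻¹' {y}) := by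
  constructor
  · intro D hD
    have h1 := hp.2.1 (Subtype.val ⁻¹' D) (hD.preimage continuous_subtype_val)
    have h2 := hfA.isClosedEmbedding_subtypeVal.isClosedMap _ h1
    convert h2 using 1
    ext y
    constructor
    · rintro ⟨x, ⟨hx, hxD⟩, rfl⟩
      exact ⟨⟨f x, x, hx, rfl⟩, ⟨⟨x, hx⟩, hxD, rfl⟩, rfl⟩
    · rintro ⟨_, ⟨x, hx, rfl⟩, rfl⟩
      exact ⟨x, ⟨x.2, hx⟩, rfl⟩
  · intro y
    by_cases hy : y ∈ f '' A
    · have h1 := (hp.2.2 ⟨y, hy⟩).image continuous_subtype_val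
      convert h1 using 1
      ext x
      constructor
      · rintro ⟨hx, hxy⟩
        exact ⟨⟨x, hx⟩, Subtype.ext hxy, rfl⟩
      · rintro ⟨x, hx, rfl⟩
        exact ⟨x.2, congrArg Subtype.val hx⟩
    · convert isCompact_empty
      ext x
      simp only [mem_inter_iff, mem_preimage, mem_singleton_iff, mem_empty_iff_false, iff_false]
      rintro ⟨hx, rfl⟩
      exact hy ⟨x, hx, rfl⟩

/-- increasing closed exhaustion with proper restrictions -/
theorem sigma_exhaust {X Y : Type*} [TopologicalSpace X] [TopologicalSpace Y] {f : X → Y}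
    (hf : IsSigmaPerfectMap f) : ∃ A : ℕ → Set X, (∀ i, IsClosed (A i)) ∧ Monotone A ∧
      (∀ x, ∃ i, x ∈ A i) ∧ ∀ i, IsProperMap (fun x : A i => f x) := by
  obtain ⟨hc, A, hU, hA⟩ := hf
  have hp := fun i => perfect_piece (hA i).1 (hA i).2.1 (hA i).2.2
  have hcl : ∀ i, IsClosed (⋃ j ∈ Iic i, A j) := fun i =>
    (finite_Iic i).isClosed_biUnion fun j _ => (hA j).1
  refine ⟨fun i => ⋃ j ∈ Iic i, A j, hcl, ?_, ?_, ?_⟩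
  · intro i j hij
    exact biUnion_subset_biUnion_left (Iic_subset_Iic.2 hij)
  · intro x
    have : x ∈ ⋃ i, A i := by rw [hU]; trivial
    obtain ⟨i, hi⟩ := mem_iUnion.1 this
    exact ⟨i, mem_biUnion (mem_Iic.2 le_rfl) hi⟩
  · intro i
    rw [isProperMap_iff_isClosedMap_and_compact_fibers]
    refine ⟨hc.comp continuous_subtype_val, ?_, ?_⟩
    · intro C hC
      have h1 := (hcl i).isClosedEmbedding_subtypeVal.isClosedMap _ hC
      have h2 : IsClosed (⋃ j ∈ Iic i, f '' (A j ∩ (Subtype.val '' C))) :=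
        (finite_Iic i).isClosed_biUnion fun j _ => (hp j).1 _ h1
      convert h2 using 1
      ext y
      simp only [mem_image, mem_iUnion, mem_inter_iff, exists_prop]
      constructor
      · rintro ⟨x, hx, rfl⟩
        obtain ⟨j, hj, hxj⟩ := mem_iUnion₂.1 x.2
        exact ⟨j, hj, x, ⟨hxj, x, hx, rfl⟩, rfl⟩
      · rintro ⟨j, hj, _, ⟨_, x, hx, rfl⟩, rfl⟩
        exact ⟨x, hx, rfl⟩
    · intro y
      have h2 : IsCompact (⋃ j ∈ Iic i, (A j ∩ f ⁻¹' {y})) :=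
        (finite_Iic i).isCompact_biUnion fun j _ => (hp j).2 y
      rw [Subtype.isCompact_iff]
      convert h2 using 1
      ext x
      simp only [mem_image, mem_iUnion, mem_inter_iff, exists_prop, mem_preimage]
      constructor
      · rintro ⟨x, hx, rfl⟩
        obtain ⟨j, hj, hxj⟩ := mem_iUnion₂.1 x.2
        exact ⟨j, hj, hxj, hx⟩
      · rintro ⟨j, hj, hxj, hx⟩
        exact ⟨⟨x, mem_iUnion₂.2 ⟨j, hj, hxj⟩⟩, hx, rfl⟩

theorem exists_beta {X Y : Type*} [TopologicalSpace X] [MetricSpace Y] {f : X → Y}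
    (hf : IsProperMap f) (α : X → ℝ) (hα : Continuous α) (hp : ∀ x, 0 < α x) :
    ∃ β : Y → ℝ, Continuous β ∧ (∀ y, 0 < β y) ∧ ∀ x, β (f x) ≤ α x := by
  obtain ⟨hc, hcl, hk⟩ := isProperMap_iff_isClosedMap_and_compact_fibers.1 hf
  obtain ⟨g, hg⟩ := exists_continuous_forall_mem_convex_of_local_const
    (X := Y) (E := ℝ) (t := fun y => {b | 0 < b ∧ ∀ x, f x = y → b ≤ α x}) (by
      intro y a ha b hb s t hs ht hst
      refine ⟨?_, fun x hx => ?_⟩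
      · have := ha.1; have := hb.1
        simp only [smul_eq_mul]
        rcases hs.eq_or_lt with rfl | h
        · have : t = 1 := by linarith
          subst this; simpa using hb.1
        · have := ha.1; have := hb.1; positivity
      · have h1 := ha.2 x hx; have h2 := hb.2 x hx
        simp only [smul_eq_mul]
        calc s * a + t * b ≤ s * α x + t * α x := by gcongr
          _ = α x := by rw [← add_mul, hst, one_mul]) (by
      intro y
      obtain ⟨c, hc0, hcα⟩ : ∃ c : ℝ, 0 < c ∧ ∀ x ∈ f ⁻¹' {y}, c < α x := by
        rcases (f ⁻¹' {y}).eq_empty_or_nonempty with he | hne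
        · exact ⟨1, one_pos, by simp [he]⟩
        · obtain ⟨x0, _, hx0⟩ := (hk y).exists_isMinOn hne hα.continuousOn
          exact ⟨α x0 / 2, half_pos (hp x0), fun x hx =>
            (half_lt_self (hp x0)).trans_le (hx0 hx)⟩
      refine ⟨c, ?_⟩
      have hopen : IsOpen {x | c < α x} := isOpen_lt continuous_const hα
      have hcl2 : IsClosed (f '' {x | c < α x}ᶜ) := hcl _ hopen.isClosed_compl
      have hy : y ∈ (f '' {x | c < α x}ᶜ)ᶜ := by
        rintro ⟨x, hx, hxy⟩
        exact hx (hcα x hxy)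
      filter_upwards [hcl2.isOpen_compl.mem_nhds hy] with y' hy'
      refine ⟨hc0, fun x hx => ?_⟩
      by_contra hlt
      exact hy' ⟨x, fun h : c < α x => hlt h.le, hx⟩)
  exact ⟨g, g.continuous, fun y => (hg y).1, fun x => (hg _).2 x rfl⟩

/-- Baire property for the source limitation topology -/
theorem baire_nat {X E : Type*} [TopologicalSpace X] [MetricSpace E] [CompleteSpace E]
    (U : ℕ → Set (X →ᵇ E))
    (hO : ∀ i, IsOpen[sourceLimitation X E] (U i))
    (hD : ∀ i, ∀ (g : X →ᵇ E) (α : X → ℝ), Continuous α → (∀ x, 0 < α x) →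
      ∃ h ∈ U i, ∀ x, dist (h x) (g x) ≤ α x) :
    @Dense _ (sourceLimitation X E) (⋂ i, U i) := by
  rw [@dense_iff_inter_open _ (sourceLimitation X E)]
  rintro W hW ⟨g0, hg0⟩
  obtain ⟨α0, hα0c, hα0p, hα0⟩ := hW g0 hg0
  let P := {a : (X →ᵇ E) × (X → ℝ) // Continuous a.2 ∧ ∀ x, 0 < a.2 x}
  have step : ∀ (i : ℕ) (a : P), ∃ b : P, (∀ x, dist (b.1.1 x) (a.1.1 x) ≤ a.1.2 x / 2) ∧
      (∀ x, b.1.2 x ≤ a.1.2 x / 2) ∧ ∀ h : X →ᵇ E, (∀ x, dist (h x) (b.1.1 x) ≤ b.1.2 x) →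
        h ∈ U i := by
    rintro i ⟨⟨g, α⟩, hc, hp⟩
    dsimp only at hc hp
    obtain ⟨h, hU, hh⟩ := hD i g (fun x => α x / 2) (hc.div_const 2) (fun x => half_pos (hp x))
    obtain ⟨γ, hγc, hγp, hγ⟩ := hO i h hU
    refine ⟨⟨⟨h, fun x => min (γ x) (α x / 2)⟩, hγc.min (hc.div_const 2),
      fun x => lt_min (hγp x) (half_pos (hp x))⟩, hh, fun x => min_le_right _ _, fun h' hh' => ?_⟩
    exact hγ h' fun x => (hh' x).trans (min_le_left _ _)
  choose N hN1 hN2 hN3 using step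
  let a0 : P := ⟨⟨g0, fun x => min (α0 x) 1⟩, hα0c.min continuous_const,
    fun x => lt_min (hα0p x) one_pos⟩
  let s : ℕ → P := fun i => Nat.rec a0 (fun i a => N i a) i
  have hs0 : s 0 = a0 := rfl
  have hs : ∀ i, s (i+1) = N i (s i) := fun i => rfl
  have hαb : ∀ i x, (s i).1.2 x ≤ (1/2) ^ i := by
    intro i x
    induction i with
    | zero => simp only [hs0, a0, pow_zero]; exact min_le_right _ _
    | succ i ih =>
      rw [hs, pow_succ]
      have := hN2 i (s i) x
      linarith
  have hstep : ∀ i x, dist ((s (i+1)).1.1 x) ((s i).1.1 x) ≤ (s i).1.2 x - (s (i+1)).1.2 x := by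
    intro i x
    have h1 := hN1 i (s i) x
    have h2 := hN2 i (s i) x
    rw [← hs] at h1 h2
    linarith
  have hdist : ∀ i j x, dist ((s (i+j)).1.1 x) ((s i).1.1 x) ≤ (s i).1.2 x - (s (i+j)).1.2 x := by
    intro i j x
    induction j with
    | zero => simp
    | succ j ih =>
      have h1 := hstep (i+j) x
      have h2 := dist_triangle ((s (i+j+1)).1.1 x) ((s (i+j)).1.1 x) ((s i).1.1 x)
      rw [← add_assoc]
      linarith
  have hcauchy : CauchySeq (fun i => (s i).1.1) := by
    refine cauchySeq_of_le_geometric (1/2) 1 (by norm_num) fun i => ?_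
    rw [dist_comm]
    rw [BoundedContinuousFunction.dist_le (by positivity)]
    intro x
    have h1 := hstep i x
    have h2 := hαb i x
    have h3 := (s (i+1)).2.2 x
    linarith
  obtain ⟨l, hl⟩ := cauchySeq_tendsto_of_complete hcauchy
  have hlim : ∀ i x, dist (l x) ((s i).1.1 x) ≤ (s i).1.2 x := by
    intro i x
    have h1 : Filter.Tendsto (fun j => (s j).1.1 x) Filter.atTop (𝓝 (l x)) :=
      ((ContinuousEvalConst.continuous_eval_const x).tendsto l).comp hl
    refine le_of_tendsto (h1.dist tendsto_const_nhds) ?_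
    filter_upwards [Filter.eventually_ge_atTop i] with j hj
    obtain ⟨d, rfl⟩ := Nat.exists_eq_add_of_le hj
    have h2 := hdist i d x
    have h3 := (s (i+d)).2.2 x
    linarith
  refine ⟨l, hα0 l fun x => (hlim 0 x).trans ?_, mem_iInter.2 fun i => ?_⟩
  · simp only [hs0, a0]; exact min_le_left _ _
  · refine hN3 i (s i) l fun x => ?_
    rw [← hs]
    exact hlim (i+1) x

theorem good_open {X Y : Type*} [MetricSpace X] [MetricSpace Y] {p : ℕ} (f : X → Y)
    (hfc : Continuous f) (A : Set X)
    (hf : IsProperMap (fun x : A => f x)) (n : ℕ) (ε : ℝ) (S : Finset (Fin p)) (q : Fin p → ℝ)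
    (B : Set Y) (hB : IsClosed B) :
    IsOpen[sourceLimitation X (EuclideanSpace ℝ (Fin p))]
      {g : X →ᵇ EuclideanSpace ℝ (Fin p) | ∀ y ∈ B,
        GoodP (fun x : A => f x) n ε S q y (fun x => g x)} := by
  intro g hg
  obtain ⟨β, hβc, hβp, hβ⟩ := PropO.margin (goodP_O _ hf n ε S q) (K := Unit)
    (fun xt => g xt.1) (by fun_prop) B hB (fun y hy _ => hg y hy)
  refine ⟨fun x => β (f x) / 2, (hβc.comp hfc).div_const 2, fun x => half_pos (hβp _), ?_⟩
  intro h hh y hy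
  refine hβ y hy () (fun x => h x) fun x hx => ?_
  have := hh x
  have h2 := hβp (f x)
  rw [← hx]
  exact this.trans_lt (half_lt_self h2)

theorem good_dense {X Y : Type*} [MetricSpace X] [MetricSpace Y] {p : ℕ} (f : X → Y)
    (A : Set X) (hA : IsClosed A)
    (hf : IsProperMap (fun x : A => f x)) (n : ℕ) (ε : ℝ) (hε : 0 < ε)
    (S : Finset (Fin p)) (q : Fin p → ℝ) (k J : ℕ)
    (hk : ∀ y, CovDimLENat ((fun x : A => f x) ⁻¹' {y}) k)
    (hdim : J + n * k + (p - S.card) < n * p)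
    (B : Set Y) (hB : IsClosed B) (Z : ℕ → Set Y) (hP : ∀ i, PZero (Z i))
    (hZ : ∀ y ∈ B, ∃ i < J + 1, y ∈ Z i)
    (g : X →ᵇ EuclideanSpace ℝ (Fin p)) (α : X → ℝ) (hα : Continuous α) (hαp : ∀ x, 0 < α x) :
    ∃ h ∈ {g : X →ᵇ EuclideanSpace ℝ (Fin p) | ∀ y ∈ B,
        GoodP (fun x : A => f x) n ε S q y (fun x => g x)}, ∀ x, dist (h x) (g x) ≤ α x := by
  let a : X → ℝ := fun x => min (α x) 1
  have ha : Continuous a := hα.min continuous_const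
  have hap : ∀ x, 0 < a x := fun x => lt_min (hαp x) one_pos
  obtain ⟨β, hβc, hβp, hβ⟩ := exists_beta hf (fun x => a x) (ha.comp continuous_subtype_val)
    (fun x => hap x)
  obtain ⟨h0, h0c, h0d, h0g⟩ := theoremS (fun x : A => f x) hf.continuous hf.isClosedMap
    (GoodP (fun x : A => f x) n ε S q) (goodP_O _ hf n ε S q) J
    (fun r hr => goodP_Z _ hf n ε hε S q k r hk (by omega)) Z hP (J+1) 0 le_rfl B hB hZ
    (fun xt => g xt.1) (by fun_prop) β hβc hβp
  let t0 : Fin 0 → unitInterval := fun i => i.elim0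
  obtain ⟨D, hD⟩ := ContinuousMap.exists_restrict_eq hA
    (⟨fun x : A => h0 (x, t0) - g x, by fun_prop⟩ : C(A, EuclideanSpace ℝ (Fin p)))
  have hD' : ∀ x : A, D x = h0 (x, t0) - g x := fun x => congrArg (fun u => u x) hD
  let s : X → ℝ := fun x => a x / max (a x) ‖D x‖
  have hmp : ∀ x, 0 < max (a x) ‖D x‖ := fun x => lt_max_of_lt_left (hap x)
  have hs : Continuous s := ha.div (ha.max D.continuous.norm) fun x => (hmp x).ne'
  have hnorm : ∀ x, ‖s x • D x‖ ≤ a x := by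
    intro x
    rw [norm_smul, Real.norm_of_nonneg (div_nonneg (hap x).le (hmp x).le), div_mul_eq_mul_div,
      div_le_iff₀ (hmp x)]
    exact mul_le_mul_of_nonneg_left (le_max_right _ _) (hap x).le
  let h : X →ᵇ EuclideanSpace ℝ (Fin p) := BoundedContinuousFunction.ofNormedAddCommGroup
    (fun x => g x + s x • D x) (by fun_prop) (‖g‖ + 1) (fun x => by
      refine (norm_add_le _ _).trans (add_le_add (g.norm_coe_le_norm x) ?_)
      exact (hnorm x).trans (min_le_right _ _))
  have hh : ∀ x, h x = g x + s x • D x := fun x => rfl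
  refine ⟨h, fun y hy => ?_, fun x => ?_⟩
  · have heq : (fun x : A => h x) = fun x => h0 (x, t0) := by
      funext x
      have h1 : ‖D x‖ ≤ a x := by
        rw [hD', ← dist_eq_norm]
        exact (h0d x t0).le.trans (hβ x)
      rw [hh]
      simp only [s]
      rw [max_eq_left h1, div_self (hap x).ne', one_smul, hD']
      abel
    rw [heq]
    exact h0g y hy t0
  · rw [hh, dist_eq_norm, add_sub_cancel_left]
    exact (hnorm x).trans (min_le_left _ _)

theorem branch_bound {X Y : Type*} [MetricSpace X] [MetricSpace Y] {p : ℕ} (f : X → Y)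
    (A : ℕ → Set X) (hAm : Monotone A) (hAU : ∀ x, ∃ i, x ∈ A i) (k m : ℕ)
    (S0 : LStruct Y (ℕ × ℕ) (ℕ × ℕ) Y) (hS0 : ∀ y, {l | y ∈ S0.L l}.encard ≤ (m : ℕ∞))
    (g : X → EuclideanSpace ℝ (Fin p))
    (hg : ∀ (i ν n : ℕ) (Sg : Finset (ℕ × ℕ)) (S : Finset (Fin p)) (q : Fin p → ℚ),
      Sg.card ≤ m → (m - Sg.card) + n * k + (p - S.card) < n * p →
      ∀ y ∈ ⋂ s ∈ Sg, S0.L s,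
        GoodP (fun x : A i => f x) n (1 / ((ν : ℝ) + 1)) S (fun c => (q c : ℝ)) y (fun x => g x))
    (n : ℕ) (yz : Y × EuclideanSpace ℝ (Fin p)) (hyz : yz ∈ BranchSet (fun x => (f x, g x)) n)
    (Sg : Finset (ℕ × ℕ)) (hSg : ∀ l ∈ Sg, yz.1 ∈ S0.L l)
    (T : Finset (Fin p × ℚ)) (hT : ∀ t ∈ T, yz.2 t.1 = (t.2 : ℝ)) :
    Sg.card + T.card + n * p ≤ n * k + m + p := by
  classical
  by_contra hlt
  push Not at hlt
  have hSgm : Sg.card ≤ m := by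
    have h1 : (Sg : Set (ℕ × ℕ)) ⊆ {l | yz.1 ∈ S0.L l} := fun l hl => hSg l hl
    have h2 := (encard_le_encard h1).trans (hS0 yz.1)
    rw [encard_coe_eq_coe_finsetCard] at h2
    exact_mod_cast h2
  have hinj : Set.InjOn (Prod.fst : Fin p × ℚ → Fin p) T := by
    rintro ⟨c, q⟩ h1 ⟨c', q'⟩ h2 h
    dsimp only at h
    subst h
    have e1 := hT _ h1
    have e2 := hT _ h2
    dsimp only at e1 e2
    rw [e1] at e2
    rw [Rat.cast_injective e2]
  let S := T.image Prod.fst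
  have hSc : S.card = T.card := Finset.card_image_of_injOn hinj
  have hSp : S.card ≤ p := by simpa using S.card_le_univ
  have hq : ∀ c : Fin p, ∃ q : ℚ, c ∈ S → yz.2 c = (q : ℝ) := by
    intro c
    by_cases hc : c ∈ S
    · obtain ⟨t, ht, rfl⟩ := Finset.mem_image.1 hc
      exact ⟨t.2, fun _ => hT t ht⟩
    · exact ⟨0, fun h => absurd h hc⟩
  choose q hq using hq
  obtain ⟨F, hFn, hF⟩ := hyz
  obtain ⟨F', hF', hF'n⟩ := Finset.exists_subset_card_eq hFn
  let e : Fin n ≃ F' := (Fintype.equivFinOfCardEq (by simpa using hF'n)).symm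
  let x : Fin n → X := fun l => (e l : X)
  have hxinj : Function.Injective x := Subtype.val_injective.comp e.injective
  have hx : ∀ l, (f (x l), g (x l)) = yz := fun l => hF _ (hF' (e l).2)
  choose I hI using hAU
  let i := Finset.univ.sup (fun l => I (x l))
  have hxi : ∀ l, x l ∈ A i := fun l =>
    hAm (Finset.le_sup (f := fun l => I (x l)) (Finset.mem_univ l)) (hI (x l))
  obtain ⟨ε, hε, hεd⟩ : ∃ ε > 0, ∀ l l', l ≠ l' → ε ≤ dist (x l) (x l') := by
    have hfin : (Set.range x).Finite := Set.finite_range x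
    have := hfin.isCompact
    have h1 : ∀ ll : Fin n × Fin n, ∃ ε : ℝ, 0 < ε ∧ (ll.1 ≠ ll.2 → ε ≤ dist (x ll.1) (x ll.2)) := by
      intro ll
      by_cases h : ll.1 = ll.2
      · exact ⟨1, one_pos, fun h' => absurd h h'⟩
      · exact ⟨_, dist_pos.2 (hxinj.ne h), fun _ => le_rfl⟩
    choose η hη1 hη2 using h1
    rcases isEmpty_or_nonempty (Fin n × Fin n) with hemp | hne
    · exact ⟨1, one_pos, fun l l' => (hemp.false (l, l')).elim⟩
    · obtain ⟨ll0, h0⟩ := Finite.exists_min η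
      exact ⟨η ll0, hη1 ll0, fun l l' h => (h0 (l, l')).trans (hη2 (l, l') h)⟩
  obtain ⟨ν, hν⟩ := exists_nat_one_div_lt hε
  refine hg i ν n Sg S q hSgm (by omega) yz.1 (mem_iInter₂.2 hSg) (fun l => ⟨x l, hxi l⟩)
    (fun l => congrArg Prod.fst (hx l)) (fun l l' h => hν.le.trans (hεd l l' h)) yz.2
    (fun c hc => hq c hc) (fun l => congrArg Prod.snd (hx l))

theorem main_aux {X Y : Type*} [MetricSpace X] [MetricSpace Y] (f : X → Y)
    (hf : IsSigmaPerfectMap f) (p k m : ℕ) (hk : DimMapLE f k) (hm : CovDimLENat Y m) :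
    ∃ H : Set (X →ᵇ EuclideanSpace ℝ (Fin p)),
      @Dense _ (sourceLimitation X (EuclideanSpace ℝ (Fin p))) H ∧
      @IsGδ _ (sourceLimitation X (EuclideanSpace ℝ (Fin p))) H ∧
      ∀ g ∈ H, ∀ n : ℕ, 1 ≤ n →
        CovDimLE (BranchSet (fun x => (f x, g x)) n)
          ((n : ℤ) * k + m - ((n : ℤ) - 1) * p) := by
  classical
  obtain ⟨A, hAc, hAm, hAU, hAp⟩ := sigma_exhaust hf
  obtain ⟨S0, hS0⟩ := exists_lstruct hm
  have hkA : ∀ i y, CovDimLENat ((fun x : A i => f x) ⁻¹' {y}) k := by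
    intro i y
    let e : ((fun x : A i => f x) ⁻¹' {y}) → (f ⁻¹' {y}) := fun x => ⟨x.1.1, x.2⟩
    have he : IsClosedEmbedding e := by
      have h1 : IsClosedEmbedding
          (fun x : ((fun x : A i => f x) ⁻¹' {y}) => (x.1.1 : X)) := by
        refine (hAc i).isClosedEmbedding_subtypeVal.comp ?_
        exact IsClosed.isClosedEmbedding_subtypeVal
          (isClosed_singleton.preimage (hAp i).continuous)
      have hec : Continuous e := by fun_prop
      exact IsClosedEmbedding.of_comp (g := (Subtype.val : f ⁻¹' {y} → X))
        IsEmbedding.subtypeVal h1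
    rcases hk y with hemp | ⟨k', hk', hd⟩
    · intro U _ _ _
      refine ⟨∅, by simp, ?_, by simp, by simp⟩
      ext t; exact (hemp.false (e t)).elim
    · exact (hd.mono (by exact_mod_cast hk')).closedEmb e he
  let I := ℕ × ℕ × ℕ × Finset (ℕ × ℕ) × Finset (Fin p) × (Fin p → ℚ)
  let cond : I → Prop := fun a =>
    a.2.2.2.1.card ≤ m ∧ (m - a.2.2.2.1.card) + a.2.2.1 * k + (p - a.2.2.2.2.1.card) < a.2.2.1 * p
  let G : I → Set (X →ᵇ EuclideanSpace ℝ (Fin p)) := fun a =>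
    {g | ∀ y ∈ ⋂ s ∈ a.2.2.2.1, S0.L s, GoodP (fun x : A a.1 => f x) a.2.2.1
      (1 / ((a.2.1 : ℝ) + 1)) a.2.2.2.2.1 (fun c => (a.2.2.2.2.2 c : ℝ)) y (fun x => g x)}
  let U : I → Set (X →ᵇ EuclideanSpace ℝ (Fin p)) := fun a => if cond a then G a else univ
  have hBc : ∀ Sg : Finset (ℕ × ℕ), IsClosed (⋂ s ∈ Sg, S0.L s) := fun Sg =>
    isClosed_biInter fun s _ => S0.closedL s
  have hUo : ∀ a, IsOpen[sourceLimitation X (EuclideanSpace ℝ (Fin p))] (U a) := by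
    intro a
    by_cases hc : cond a
    · simp only [U, if_pos hc]
      exact good_open f hf.1 (A a.1) (hAp a.1) _ _ _ _ _ (hBc _)
    · simp only [U, if_neg hc]
      exact @isOpen_univ _ (sourceLimitation X (EuclideanSpace ℝ (Fin p)))
  have hUd : ∀ a, ∀ (g : X →ᵇ EuclideanSpace ℝ (Fin p)) (α : X → ℝ), Continuous α →
      (∀ x, 0 < α x) → ∃ h ∈ U a, ∀ x, dist (h x) (g x) ≤ α x := by
    intro a g α hα hαp
    by_cases hc : cond a
    · simp only [U, if_pos hc]
      refine good_dense f (A a.1) (hAc _) (hAp _) _ _ (by positivity) _ _ k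
        (m - a.2.2.2.1.card) (hkA _) hc.2 _ (hBc _)
        (fun i => {y | {l | y ∈ S0.L l}.encard = ((a.2.2.2.1.card + i : ℕ) : ℕ∞)})
        (fun i => S0.pZero_stratum _) ?_ g α hα hαp
      intro y hy
      have h1 : (a.2.2.2.1 : Set (ℕ × ℕ)) ⊆ {l | y ∈ S0.L l} := fun l hl =>
        mem_iInter₂.1 hy l hl
      have h2 := encard_le_encard h1
      rw [encard_coe_eq_coe_finsetCard] at h2
      have h3 := hS0 y
      obtain ⟨c, hc'⟩ := ENat.ne_top_iff_exists.1 (ne_top_of_le_ne_top (ENat.coe_ne_top m) h3)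
      rw [← hc'] at h2 h3
      have h2' : a.2.2.2.1.card ≤ c := by exact_mod_cast h2
      have h3' : c ≤ m := by exact_mod_cast h3
      refine ⟨c - a.2.2.2.1.card, by omega, ?_⟩
      show _ = _
      rw [← hc', Nat.add_sub_cancel' h2']
    · simp only [U, if_neg hc]
      exact ⟨g, trivial, fun x => by rw [dist_self]; exact (hαp x).le⟩
  haveI : Nonempty I := ⟨(0, 0, 0, ∅, ∅, fun _ => 0)⟩
  obtain ⟨en, hen⟩ := exists_surjective_nat I
  have hUeq : ⋂ i, U (en i) = ⋂ a, U a := hen.iInter_comp U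
  refine ⟨⋂ a, U a, ?_, ?_, ?_⟩
  · rw [← hUeq]
    exact baire_nat _ (fun i => hUo _) (fun i => hUd _)
  · exact @IsGδ.iInter_of_isOpen _ _ (sourceLimitation X (EuclideanSpace ℝ (Fin p))) _ _ hUo
  · intro g hg n hn
    have hb := branch_bound f A hAm hAU k m S0 hS0 g (by
      intro i ν n Sg S q h1 h2
      have h3 := mem_iInter.1 hg (i, ν, n, Sg, S, q)
      have h4 : cond (i, ν, n, Sg, S, q) := ⟨h1, h2⟩
      simp only [U, if_pos h4] at h3
      exact h3) n
    by_cases hd : n * p ≤ n * k + m + p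
    · right
      refine ⟨n * k + m + p - n * p, ?_, ?_⟩
      · rw [Nat.cast_sub hd]; push_cast; apply le_of_eq; ring
      · let S1 := (S0.prodE p).comap (Subtype.val : BranchSet (fun x => (f x, g x)) n → _)
          IsInducing.subtypeVal
        refine S1.covDim _ fun z => ?_
        by_contra hlt
        push Not at hlt
        obtain ⟨W, hW, hWc⟩ := exists_subset_encard_eq (Order.add_one_le_of_lt hlt)
        have hWf : W.Finite := finite_of_encard_eq_coe (k := n * k + m + p - n * p + 1) (by
          rw [hWc]; push_cast; rfl)
        lift W to Finset ((ℕ × ℕ) ⊕ (Fin p × ℚ)) using hWf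
        rw [encard_coe_eq_coe_finsetCard] at hWc
        have hWc' : W.card = n * k + m + p - n * p + 1 := by exact_mod_cast hWc
        have h1 := hb z.1 z.2 W.toLeft (fun l hl => hW (Finset.mem_toLeft.1 hl)) W.toRight
          (fun t ht => hW (Finset.mem_toRight.1 ht))
        have h2 := W.card_toLeft_add_card_toRight
        omega
    · left
      refine ⟨fun z => hd ?_⟩
      simpa using hb z.1 z.2 ∅ (by simp) ∅ (by simp)

theorem final_branched {X Y : Type*} [TopologicalSpace X] [TopologicalSpace.MetrizableSpace X]
    [TopologicalSpace Y] [TopologicalSpace.MetrizableSpace Y]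
    (hX : FiniteDimSpace X) (hY : FiniteDimSpace Y)
    (f : X → Y) (hf : IsSigmaPerfectMap f) (p : ℕ) (hp : 1 ≤ p) :
    ∃ H : Set (X →ᵇ EuclideanSpace ℝ (Fin p)),
      @Dense _ (sourceLimitation X (EuclideanSpace ℝ (Fin p))) H ∧
      @IsGδ _ (sourceLimitation X (EuclideanSpace ℝ (Fin p))) H ∧
      ∀ g ∈ H, ∀ n : ℕ, 1 ≤ n → ∀ k m : ℕ, DimMapLE f k → CovDimLE Y m →
        CovDimLE (BranchSet (fun x => (f x, g x)) n)
          ((n : ℤ) * ((k : ℤ) + m) - ((n : ℤ) - 1) * ((p : ℤ) + m)) := by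
  classical
  letI := TopologicalSpace.metrizableSpaceMetric X
  letI := TopologicalSpace.metrizableSpaceMetric Y
  by_cases hk : ∃ k : ℕ, DimMapLE f k
  · have hY' : ∃ m : ℕ, CovDimLENat Y m := hY
    obtain ⟨H, hH1, hH2, hH3⟩ := main_aux f hf p (Nat.find hk) (Nat.find hY')
      (Nat.find_spec hk) (Nat.find_spec hY')
    refine ⟨H, hH1, hH2, fun g hg n hn k m hfk hYm => ?_⟩
    rcases hYm with hemp | ⟨m', hm', hd⟩
    · exact Or.inl ⟨fun z => hemp.false z.1.1⟩
    · have h1 : Nat.find hk ≤ k := Nat.find_min' hk hfk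
      have h2 : Nat.find hY' ≤ m' := Nat.find_min' hY' hd
      have h3 : (Nat.find hk : ℤ) ≤ k := by exact_mod_cast h1
      have h4 : (Nat.find hY' : ℤ) ≤ m := le_trans (by exact_mod_cast h2) hm'
      rcases hH3 g hg n hn with he | ⟨d, hd, hdd⟩
      · exact Or.inl he
      · refine Or.inr ⟨d, hd.trans ?_, hdd⟩
        have h5 : (n : ℤ) * (Nat.find hk : ℤ) ≤ n * k :=
          mul_le_mul_of_nonneg_left h3 (by positivity)
        linarith [h5, h4]
  · refine ⟨univ, @dense_univ _ (sourceLimitation X (EuclideanSpace ℝ (Fin p))),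
      @IsGδ.univ _ (sourceLimitation X (EuclideanSpace ℝ (Fin p))), ?_⟩
    intro g _ n _ k m hfk
    exact absurd ⟨k, hfk⟩ hk

/-- Parametric Hurewicz theorem on regularly branched maps. -/
theorem statement0 {X Y : Type*} [TopologicalSpace X] [TopologicalSpace.MetrizableSpace X]
    [TopologicalSpace Y] [TopologicalSpace.MetrizableSpace Y]
    (hX : FiniteDimSpace X) (hY : FiniteDimSpace Y)
    (f : X → Y) (hf : IsSigmaPerfectMap f) (p : ℕ) (hp : 1 ≤ p) :
    ∃ H : Set (X →ᵇ EuclideanSpace ℝ (Fin p)),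
      @Dense _ (sourceLimitation X (EuclideanSpace ℝ (Fin p))) H ∧
      @IsGδ _ (sourceLimitation X (EuclideanSpace ℝ (Fin p))) H ∧
      ∀ g ∈ H, ∀ n : ℕ, 1 ≤ n → ∀ k m : ℕ, DimMapLE f k → CovDimLE Y m →
        CovDimLE (BranchSet (fun x => (f x, g x)) n)
          ((n : ℤ) * ((k : ℤ) + m) - ((n : ℤ) - 1) * ((p : ℤ) + m)) := by
  exact final_branched hX hY f hf p hp
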